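/- arXiv:2004.06308 — 2 statements merged into one kernel-verified Lean document; each statement's English description precedes it below -/
import Mathlib

section
/- Let ν ≥ 0 and let R be the smallest positive zero of ϕ_ν′ (which exists). Then R < x for every x ∈ Z_ν, and the series Σ_{k=1}^∞ R^{2k} σ_k(ν) converges with Σ_{k=1}^∞ R^{2k} σ_k(ν) = 1/2, provided ν is sufficiently large. -/
/-- The Bessel function of the first kind of order `ν`,
`J_ν(x) = Σ_{m=0}^∞ ((-1)^m / (m! Γ(m+ν+1))) (x/2)^{2m+ν}` (for `x > 0`). -/
noncomputable def besselJ (ν x : ℝ) : ℝ :=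
  ∑' m : ℕ, ((-1 : ℝ) ^ m / (m.factorial * Real.Gamma (m + ν + 1))) * (x / 2) ^ (2 * (m : ℝ) + ν)

/-- `Z_ν`, the set of positive zeros of `J_ν`. -/
def besselZeros (ν : ℝ) : Set ℝ := {x : ℝ | 0 < x ∧ besselJ ν x = 0}

/-- The Rayleigh sum `σ_k(ν) = Σ_{x ∈ Z_ν} x^{-2k}`. -/
noncomputable def rayleigh (k : ℕ) (ν : ℝ) : ℝ :=
  ∑' x : besselZeros ν, ((x : ℝ) ^ (2 * k))⁻¹

/-- The normalised Bessel function
`ϕ_ν(z) = z Σ_{m=0}^∞ ((-1)^m Γ(ν+1)/(m! Γ(ν+m+1))) (z/2)^{2m}`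
(equal to `2^ν Γ(ν+1) z^{1-ν} J_ν(z)` for `z > 0`). -/
noncomputable def phi2 (ν : ℝ) (z : ℝ) : ℝ :=
  z * ∑' m : ℕ, ((-1 : ℝ) ^ m * Real.Gamma (ν + 1) /
    (m.factorial * Real.Gamma (ν + m + 1))) * (z / 2) ^ (2 * m)

open Complex Metric Set Filter Topology

lemma aux_factor (g : ℂ → ℂ) (hg : Differentiable ℂ g) (T : Finset ℝ)
    (hT : ∀ a ∈ T, 0 < a ∧ g a = 0) :
    ∃ h : ℂ → ℂ, Differentiable ℂ h ∧ ∀ w, g w = (∏ a ∈ T, (1 - w / (a : ℂ))) * h w := by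
  classical
  induction T using Finset.induction_on with
  | empty => exact ⟨g, hg, by simp⟩
  | insert a T haT ih =>
    obtain ⟨h, hh, hgh⟩ := ih (fun b hb => hT b (Finset.mem_insert_of_mem hb))
    obtain ⟨ha, hga⟩ := hT a (Finset.mem_insert_self a T)
    have hac : (a : ℂ) ≠ 0 := by exact_mod_cast ha.ne'
    have hha : h a = 0 := by
      have h1 := hgh a
      rw [hga] at h1
      rcases mul_eq_zero.1 h1.symm with h2 | h2
      · exfalso
        obtain ⟨b, hb, hb2⟩ := Finset.prod_eq_zero_iff.1 h2
        have hb0 : (b : ℂ) ≠ 0 := by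
          exact_mod_cast (hT b (Finset.mem_insert_of_mem hb)).1.ne'
        have : (a : ℂ) = b := by
          field_simp at hb2
          linear_combination -hb2
        have : a = b := by exact_mod_cast this
        exact haT (this ▸ hb)
      · exact h2
    refine ⟨fun w => -(a : ℂ) * dslope h a w, ?_, ?_⟩
    · have : DifferentiableOn ℂ (dslope h a) univ :=
        (Complex.differentiableOn_dslope univ_mem).2 hh.differentiableOn
      exact (differentiableOn_univ.1 this).const_mul _
    · intro w
      rw [Finset.prod_insert haT, hgh w]
      have h1 : h w = (w - a) * dslope h a w := by
        have := sub_smul_dslope h (a : ℂ) w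
        simp only [smul_eq_mul, hha, sub_zero] at this
        exact this.symm
      rw [h1]
      field_simp
      ring

lemma aux_bound (g : ℂ → ℂ) (hg : Differentiable ℂ g) (g0 : g 0 = 1)
    (hgr : ∀ w, ‖g w‖ ≤ Real.exp (2 * √‖w‖))
    (hz : ∀ w, g w = 0 → ∃ a : ℝ, 0 < a ∧ w = a)
    (hs : ∀ w, g w = 0 → deriv g w ≠ 0) (R : ℝ) (hR : 0 < R) (T : Finset ℝ)
    (hT : ∀ a, a ∈ T ↔ 0 < a ∧ a ≤ R ∧ g a = 0) (x : ℂ) (hx : ‖x‖ ≤ R / 4) (hgx : g x ≠ 0) :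
    ‖deriv g x / g x - ∑ a ∈ T, 1 / (x - a)‖ ≤ 16 * √2 / √R := by
  obtain ⟨h, hh, hgh⟩ := aux_factor g hg T (fun a ha => ⟨((hT a).1 ha).1, ((hT a).1 ha).2.2⟩)
  set P : ℂ → ℂ := fun w => ∏ a ∈ T, (1 - w / (a : ℂ)) with hP
  have hPd : Differentiable ℂ P := by
    rw [hP]; fun_prop
  have hgP : g = fun w => P w * h w := funext hgh
  have hder : ∀ w, deriv g w = deriv P w * h w + P w * deriv h w := by
    intro w
    rw [hgP]
    exact deriv_fun_mul (hPd w) (hh w)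
  have h0 : h 0 = 1 := by
    have := hgh 0
    simpa [g0] using this.symm
  have hne : ∀ w ∈ ball (0 : ℂ) R, h w ≠ 0 := by
    intro w hw h1
    have hgw : g w = 0 := by rw [hgh, h1, mul_zero]
    obtain ⟨a, ha, rfl⟩ := hz w hgw
    have haR : a < R := by
      simpa [abs_of_pos ha] using hw
    have haT : a ∈ T := (hT a).2 ⟨ha, haR.le, hgw⟩
    apply hs _ hgw
    rw [hder, h1]
    have : P a = 0 := by
      apply Finset.prod_eq_zero haT
      have : (a : ℂ) ≠ 0 := by exact_mod_cast ha.ne'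
      simp [this]
    rw [this]; ring
  set M := 2 * √(2 * R) with hM
  have hMpos : 0 < M := by positivity
  have hbd : ∀ w ∈ ball (0 : ℂ) R, ‖h w‖ ≤ Real.exp M := by
    intro w hw
    apply Complex.norm_le_of_forall_mem_frontier_norm_le (U := ball 0 (2 * R)) isBounded_ball
      hh.diffContOnCl
    · intro z hz'
      rw [frontier_ball _ (by positivity)] at hz'
      have hzn : ‖z‖ = 2 * R := by simpa using hz'
      have h1 : 1 ≤ ‖P z‖ := by
        rw [hP]
        simp only [norm_prod]
        rw [← Finset.prod_const_one (s := T)]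
        apply Finset.prod_le_prod (fun _ _ => zero_le_one)
        intro a ha
        obtain ⟨ha0, haR, -⟩ := (hT a).1 ha
        have h3 : 2 ≤ ‖z / (a : ℂ)‖ := by
          rw [norm_div, hzn, Complex.norm_real, Real.norm_of_nonneg ha0.le, le_div_iff₀ ha0]
          linarith
        have h4 := norm_sub_norm_le (z / (a : ℂ)) 1
        rw [norm_sub_rev, norm_one] at h4
        linarith
      have h2 := hgr z
      rw [hgh z, norm_mul, hzn] at h2
      calc ‖h z‖ = 1 * ‖h z‖ := by ring
        _ ≤ ‖P z‖ * ‖h z‖ := by gcongr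
        _ ≤ _ := h2
    · apply subset_closure
      exact ball_subset_ball (by linarith) hw
  obtain ⟨q, hq0, hq⟩ := (DifferentiableOn.isExactOn_ball (f := fun w => deriv h w / h w)
    (c := 0) (r := R) (DifferentiableOn.div (hh.deriv.differentiableOn) hh.differentiableOn hne)).with_val_at 0 0
  have hexp : ∀ w ∈ ball (0 : ℂ) R, h w = exp (q w) := by
    intro w hw
    have hconst : h w * exp (-q w) = h 0 * exp (-q 0) := by
      apply IsOpen.is_const_of_deriv_eq_zero (𝕜 := ℂ) (f := fun w => h w * exp (-q w)) (s := ball 0 R) isOpen_ball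
        (convex_ball _ _).isPreconnected
      · intro z hz'
        exact (((hh z).hasDerivAt.mul ((hq z hz').neg.cexp)).differentiableAt).differentiableWithinAt
      · intro z hz'
        have := ((hh z).hasDerivAt.mul ((hq z hz').neg.cexp)).deriv
        have hn := hne z hz'
        rw [show (fun w => h w * exp (-q w)) = h * fun w => exp ((-q) w) from rfl, this]
        simp
        field_simp
        ring
      · exact hw
      · exact mem_ball_self hR
    rw [h0, hq0] at hconst
    simp only [neg_zero, exp_zero, mul_one] at hconst
    rw [exp_neg] at hconst
    have := exp_ne_zero (q w)
    field_simp at hconst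
    exact hconst
  have hre : MapsTo q (ball 0 R) {z | z.re ≤ M} := by
    intro w hw
    have := hbd w hw
    rw [hexp w hw, norm_exp] at this
    exact Real.exp_le_exp.1 this
  have hqd : DifferentiableOn ℂ q (ball 0 R) := fun z hz' =>
    (hq z hz').differentiableAt.differentiableWithinAt
  have hq2 : ∀ z ∈ closedBall (0 : ℂ) (R / 2), ‖q z‖ ≤ 2 * M := by
    intro z hz'
    have hzn : ‖z‖ ≤ R / 2 := by simpa using hz'
    have hzb : z ∈ ball (0 : ℂ) R := by simp; linarith
    refine (Complex.borelCaratheodory_zero hMpos hqd hre hR hzb hq0).trans ?_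
    rw [div_le_iff₀ (by linarith)]
    gcongr
    linarith
  have hsub : closedBall x (R / 4) ⊆ closedBall 0 (R / 2) := by
    apply closedBall_subset_closedBall'
    simp; linarith
  have hsub2 : closedBall (0 : ℂ) (R / 2) ⊆ ball 0 R := closedBall_subset_ball (by linarith)
  have hqx : ‖deriv q x‖ ≤ 2 * M / (R / 4) := by
    apply Complex.norm_deriv_le_of_forall_mem_sphere_norm_le (by positivity)
    · apply DifferentiableOn.diffContOnCl
      rw [closure_ball _ (by positivity)]
      exact hqd.mono (hsub.trans hsub2)
    · intro z hz'
      exact hq2 z (hsub (sphere_subset_closedBall hz'))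
  have hxb : x ∈ ball (0 : ℂ) R := hsub2 (hsub (mem_closedBall_self (by positivity)))
  have hPx : P x ≠ 0 := fun h1 => hgx (by rw [hgh]; simp only [hP] at h1; rw [h1, zero_mul])
  have hlog : deriv P x / P x = ∑ a ∈ T, 1 / (x - a) := by
    have h1 : logDeriv P x = ∑ a ∈ T, logDeriv (fun w : ℂ => 1 - w / (a : ℂ)) x := by
      rw [hP]
      apply logDeriv_prod
      · intro a ha h2
        exact hPx (Finset.prod_eq_zero ha h2)
      · intro a ha
        fun_prop
    rw [← logDeriv_apply, h1]
    apply Finset.sum_congr rfl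
    intro a ha
    have ha0 : (a : ℂ) ≠ 0 := by exact_mod_cast ((hT a).1 ha).1.ne'
    have hne2 : 1 - x / (a : ℂ) ≠ 0 := fun h2 => hPx (Finset.prod_eq_zero ha h2)
    have hne3 : x - a ≠ 0 := by
      intro h3
      apply hne2
      field_simp
      linear_combination -h3
    rw [logDeriv_apply]
    have : deriv (fun w : ℂ => 1 - w / (a : ℂ)) x = - (1 / (a : ℂ)) := by
      simp
    rw [this, div_eq_div_iff hne2 hne3]
    field_simp
    ring
  have hkey : deriv g x / g x - ∑ a ∈ T, 1 / (x - a) = deriv q x := by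
    rw [← hlog, (hq x hxb).deriv, hder, hgh x]
    have := hne x hxb
    change (deriv P x * h x + P x * deriv h x) / (P x * h x) - _ = _
    field_simp
    ring
  rw [hkey]
  refine hqx.trans (le_of_eq ?_)
  rw [hM, Real.sqrt_mul (by norm_num)]
  have : √R * √R = R := Real.mul_self_sqrt hR.le
  have h3 : 0 < √R := Real.sqrt_pos.2 hR
  rw [div_eq_div_iff (by positivity) (by positivity)]
  linear_combination (4 * √2) * this

lemma aux_finite (g : ℂ → ℂ) (hg : Differentiable ℂ g) (g0 : g 0 = 1) (R : ℝ) :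
    {a : ℝ | 0 < a ∧ a ≤ R ∧ g a = 0}.Finite := by
  have hfin : ({w | g w = 0} ∩ closedBall (0 : ℂ) R).Finite := by
    by_contra hinf
    obtain ⟨p, hp, hacc⟩ := Set.Infinite.exists_accPt_of_subset_isCompact hinf
      (isCompact_closedBall (0 : ℂ) R) inter_subset_right
    rw [accPt_iff_frequently_nhdsNE] at hacc
    have := AnalyticOnNhd.eqOn_zero_of_preconnected_of_frequently_eq_zero
      (f := g) (U := univ) (z₀ := p) (fun z _ => hg.analyticAt z) isPreconnected_univ (mem_univ _)
      (hacc.mono fun z hz => hz.1)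
    have := this (mem_univ 0)
    simp [g0] at this
  refine Set.Finite.subset (hfin.preimage (f := fun a : ℝ => (a : ℂ))
    Complex.ofReal_injective.injOn) ?_
  rintro a ⟨h1, h2, h3⟩
  refine ⟨h3, ?_⟩
  simpa [abs_of_pos h1] using h2

lemma aux_hasSum (g : ℂ → ℂ) (hg : Differentiable ℂ g) (g0 : g 0 = 1)
    (hgr : ∀ w, ‖g w‖ ≤ Real.exp (2 * √‖w‖))
    (hz : ∀ w, g w = 0 → ∃ a : ℝ, 0 < a ∧ w = a)
    (hs : ∀ w, g w = 0 → deriv g w ≠ 0) (x : ℝ) (hx : 0 ≤ x)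
    (hxz : ∀ a : ℝ, 0 < a → g a = 0 → x < a) :
    HasSum (fun a : {a : ℝ // 0 < a ∧ g a = 0} => 1 / ((a : ℝ) - x))
      (-(deriv g x / g x).re) := by
  classical
  have hgx : g x ≠ 0 := by
    intro h
    rcases hx.eq_or_lt with h0 | h0
    · rw [← h0] at h; simp [g0] at h
    · exact lt_irrefl _ (hxz x h0 h)
  set L := -(deriv g x / g x).re with hL
  set C := 16 * √2 with hC
  have key : ∀ R : ℝ, 0 < R → 4 * x ≤ R → ∀ T : Finset ℝ,
      (∀ a, a ∈ T ↔ 0 < a ∧ a ≤ R ∧ g a = 0) →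
      |L - ∑ a ∈ T, 1 / (a - x)| ≤ C / √R := by
    intro R hR hxR T hT
    have := aux_bound g hg g0 hgr hz hs R hR T hT x
      (by simp [abs_of_nonneg hx]; linarith) hgx
    refine le_trans ?_ this
    refine le_trans (le_of_eq ?_) (Complex.abs_re_le_norm _)
    rw [← abs_neg]
    congr 1
    rw [hL, Complex.sub_re, Complex.re_sum]
    have : ∀ a ∈ T, (1 / ((x : ℂ) - a)).re = - (1 / (a - x)) := by
      intro a ha
      rw [show (1 / ((x : ℂ) - a)) = ((1 / (x - a) : ℝ) : ℂ) by push_cast; rfl, Complex.ofReal_re]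
      rw [← neg_sub a x, div_neg]
    rw [Finset.sum_congr rfl this, Finset.sum_neg_distrib]
    ring
  have hsqrt : Tendsto (fun R : ℝ => C / √R) atTop (𝓝 0) :=
    tendsto_const_nhds.div_atTop Real.tendsto_sqrt_atTop
  have hnn : ∀ a : {a : ℝ // 0 < a ∧ g a = 0}, 0 ≤ 1 / ((a : ℝ) - x) := by
    intro a
    have := hxz a a.2.1 a.2.2
    apply div_nonneg zero_le_one
    linarith
  apply hasSum_of_isLUB_of_nonneg _ hnn
  constructor
  · rintro _ ⟨s, rfl⟩
    have hlim : Tendsto (fun R : ℝ => L + C / √R) atTop (𝓝 (L + 0)) := hsqrt.const_add L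
    rw [add_zero] at hlim
    apply ge_of_tendsto hlim
    have hev : ∀ᶠ R : ℝ in atTop, ∀ a ∈ s, (a : ℝ) ≤ R := by
      rw [Filter.eventually_all_finset]
      intro a _
      exact eventually_ge_atTop _
    filter_upwards [hev, eventually_gt_atTop 0, eventually_ge_atTop (4 * x)] with R h1 h2 h3
    set T := (aux_finite g hg g0 R).toFinset with hTd
    have hT : ∀ a, a ∈ T ↔ 0 < a ∧ a ≤ R ∧ g a = 0 := by
      intro a; simp [hTd]
    have h4 := (abs_le.1 (key R h2 h3 T hT)).1
    have h5 : ∑ a ∈ s, 1 / ((a : ℝ) - x) ≤ ∑ a ∈ T, 1 / (a - x) := by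
      rw [show ∑ a ∈ s, 1 / ((a : ℝ) - x) = ∑ a ∈ s.map (Function.Embedding.subtype _), 1 / (a - x)
        by rw [Finset.sum_map]; rfl]
      apply Finset.sum_le_sum_of_subset_of_nonneg
      · intro a ha
        obtain ⟨b, hb, rfl⟩ := Finset.mem_map.1 ha
        exact (hT _).2 ⟨b.2.1, h1 b hb, b.2.2⟩
      · intro a ha _
        obtain ⟨h6, -, h7⟩ := (hT a).1 ha
        exact hnn ⟨a, h6, h7⟩
    linarith
  · intro b hb
    have hlim : Tendsto (fun R : ℝ => L - C / √R) atTop (𝓝 (L - 0)) := hsqrt.const_sub L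
    rw [sub_zero] at hlim
    apply le_of_tendsto hlim
    filter_upwards [eventually_gt_atTop 0, eventually_ge_atTop (4 * x)] with R h2 h3
    set T := (aux_finite g hg g0 R).toFinset with hTd
    have hT : ∀ a, a ∈ T ↔ 0 < a ∧ a ≤ R ∧ g a = 0 := by
      intro a; simp [hTd]
    have h4 := (abs_le.1 (key R h2 h3 T hT)).2
    have h5 : ∑ a ∈ T, 1 / (a - x) ≤ b := by
      apply hb
      refine ⟨T.subtype (fun a : ℝ => 0 < a ∧ g a = 0), ?_⟩
      dsimp only
      rw [Finset.sum_subtype_eq_sum_filter (f := fun a : ℝ => 1 / (a - x))]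
      rw [Finset.filter_true_of_mem]
      intro a ha
      exact ⟨((hT a).1 ha).1, ((hT a).1 ha).2.2⟩
    linarith

/-- Coefficients of the normalised Bessel series in the variable `z ^ 2 / 4`. -/
noncomputable def bc (ν : ℝ) (m : ℕ) : ℝ :=
  (-1 : ℝ) ^ m * Real.Gamma (ν + 1) / (m.factorial * Real.Gamma (ν + m + 1))

/-- The normalised Bessel series in the variable `w = z ^ 2 / 4`. -/
noncomputable def bg (ν : ℝ) (w : ℂ) : ℂ := ∑' m : ℕ, (bc ν m : ℂ) * w ^ m

lemma bc_zero (ν : ℝ) (hν : 0 ≤ ν) : bc ν 0 = 1 := by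
  have : Real.Gamma (ν + 1) ≠ 0 := (Real.Gamma_pos_of_pos (by linarith)).ne'
  simp [bc, this]

lemma bc_succ (ν : ℝ) (hν : 0 ≤ ν) (m : ℕ) :
    bc ν (m + 1) * ((m + 1) * (ν + m + 1)) = - bc ν m := by
  have h1 : 0 < Real.Gamma (ν + m + 1) := Real.Gamma_pos_of_pos (by positivity)
  have h2 : Real.Gamma (ν + (m + 1 : ℕ) + 1) = (ν + m + 1) * Real.Gamma (ν + m + 1) := by
    rw [← Real.Gamma_add_one (by positivity)]
    push_cast; ring_nf
  have h3 : (m.factorial : ℝ) ≠ 0 := by positivity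
  have h4 : ν + m + 1 ≠ 0 := by positivity
  unfold bc
  rw [h2, Nat.factorial_succ]
  push_cast
  field_simp
  ring

lemma bc_shift (ν : ℝ) (hν : 0 ≤ ν) (m : ℕ) :
    bc (ν + 1) m * (ν + m + 1) = bc ν m * (ν + 1) := by
  have h1 : 0 < Real.Gamma (ν + m + 1) := Real.Gamma_pos_of_pos (by positivity)
  have h0 : 0 < Real.Gamma (ν + 1) := Real.Gamma_pos_of_pos (by positivity)
  have h2 : Real.Gamma (ν + 1 + m + 1) = (ν + m + 1) * Real.Gamma (ν + m + 1) := by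
    rw [← Real.Gamma_add_one (by positivity)]
    ring_nf
  have h3 : (m.factorial : ℝ) ≠ 0 := by positivity
  have h4 : ν + m + 1 ≠ 0 := by positivity
  unfold bc
  rw [h2, Real.Gamma_add_one (by positivity : ν + 1 ≠ 0)]
  field_simp

lemma bc_bound (ν : ℝ) (hν : 0 ≤ ν) (m : ℕ) : |bc ν m| ≤ (1 / (m.factorial : ℝ)) ^ 2 := by
  induction m with
  | zero => simp [bc_zero ν hν]
  | succ m ih =>
    have h := bc_succ ν hν m
    have h2 : |bc ν (m + 1)| * ((m + 1) * (ν + m + 1)) = |bc ν m| := by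
      rw [← abs_neg (bc ν m), ← h, abs_mul, abs_of_nonneg (a := ((m : ℝ) + 1) * (ν + m + 1))
        (by positivity)]
    have h3 : |bc ν (m + 1)| * ((m + 1) * (m + 1)) ≤ |bc ν m| := by
      rw [← h2]
      gcongr
      linarith
    rw [Nat.factorial_succ]
    have h5 : |bc ν (m + 1)| ≤ |bc ν m| / ((m + 1) * (m + 1)) := by
      rw [le_div_iff₀ (by positivity)]; exact h3
    refine h5.trans ?_
    refine (div_le_div_of_nonneg_right ih (by positivity)).trans (le_of_eq ?_)
    push_cast
    field_simp

lemma exp_summable (r : ℝ) : Summable (fun m : ℕ => r ^ m / (m.factorial : ℝ)) :=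
  Real.summable_pow_div_factorial r

lemma bc_term_bound (ν : ℝ) (hν : 0 ≤ ν) (w : ℂ) (m : ℕ) :
    ‖(bc ν m : ℂ) * w ^ m‖ ≤ ‖w‖ ^ m / (m.factorial : ℝ) := by
  rw [norm_mul, norm_pow, Complex.norm_real, Real.norm_eq_abs]
  have h1 := bc_bound ν hν m
  have h2 : (1 / (m.factorial : ℝ)) ^ 2 ≤ 1 / (m.factorial : ℝ) := by
    apply pow_le_of_le_one (by positivity) _ (by norm_num)
    rw [div_le_one (by positivity)]
    exact_mod_cast Nat.one_le_iff_ne_zero.2 (Nat.factorial_ne_zero m)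
  calc |bc ν m| * ‖w‖ ^ m ≤ 1 / (m.factorial : ℝ) * ‖w‖ ^ m := by
        gcongr; exact h1.trans h2
    _ = _ := by ring

lemma bg_summable (ν : ℝ) (hν : 0 ≤ ν) (w : ℂ) :
    Summable (fun m : ℕ => (bc ν m : ℂ) * w ^ m) :=
  Summable.of_norm_bounded (exp_summable ‖w‖) (bc_term_bound ν hν w)

lemma bg_growth (ν : ℝ) (hν : 0 ≤ ν) (w : ℂ) : ‖bg ν w‖ ≤ Real.exp (2 * √‖w‖) := by
  set s := √‖w‖ with hs
  have hs0 : 0 ≤ s := Real.sqrt_nonneg _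
  have hsw : ‖w‖ = s ^ 2 := (Real.sq_sqrt (norm_nonneg w)).symm
  have h2 : Real.exp (2 * s) = ∑' m : ℕ, (2 * s) ^ m / (m.factorial : ℝ) := by
    rw [Real.exp_eq_exp_ℝ, NormedSpace.exp_eq_tsum_div]
  have hterm : ∀ m : ℕ, ‖(bc ν m : ℂ) * w ^ m‖ ≤ (s ^ m / (m.factorial : ℝ)) ^ 2 := by
    intro m
    rw [norm_mul, norm_pow, Complex.norm_real, Real.norm_eq_abs, hsw]
    calc |bc ν m| * (s ^ 2) ^ m ≤ (1 / (m.factorial : ℝ)) ^ 2 * (s ^ 2) ^ m := by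
          gcongr; exact bc_bound ν hν m
      _ = _ := by rw [div_pow, div_pow, ← pow_mul, ← pow_mul, mul_comm 2 m]; ring
  have hS : Summable (fun m : ℕ => (s ^ m / (m.factorial : ℝ)) * Real.exp s) :=
    (exp_summable s).mul_right _
  have hle : ∀ m : ℕ, s ^ m / (m.factorial : ℝ) ≤ Real.exp s := by
    intro m
    exact Real.pow_div_factorial_le_exp s hs0 m
  have hb : ∀ m : ℕ, ‖(bc ν m : ℂ) * w ^ m‖ ≤ (s ^ m / (m.factorial : ℝ)) * Real.exp s := by
    intro m
    refine (hterm m).trans ?_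
    rw [pow_two]
    gcongr
    exact hle m
  have := tsum_of_norm_bounded hS.hasSum hb
  refine this.trans (le_of_eq ?_)
  rw [tsum_mul_right, two_mul, Real.exp_add]
  congr 1
  rw [Real.exp_eq_exp_ℝ, NormedSpace.exp_eq_tsum_div]

lemma bg_diff (ν : ℝ) (hν : 0 ≤ ν) : Differentiable ℂ (bg ν) := by
  intro w
  have := differentiableOn_tsum_of_summable_norm (F := fun (m : ℕ) (w : ℂ) => (bc ν m : ℂ) * w ^ m)
    (U := ball 0 (‖w‖ + 1)) (exp_summable (‖w‖ + 1)) (fun i => by fun_prop) isOpen_ball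
    (fun i z hz => (bc_term_bound ν hν z i).trans (by
      have : ‖z‖ ≤ ‖w‖ + 1 := by simpa using (mem_ball.1 hz).le
      gcongr))
  exact this.differentiableAt (isOpen_ball.mem_nhds (by simp))

lemma bg_deriv (ν : ℝ) (hν : 0 ≤ ν) (w : ℂ) :
    HasDerivAt (bg ν) (-(bg (ν + 1) w) / (ν + 1)) w := by
  have h1 := hasSum_deriv_of_summable_norm (F := fun (m : ℕ) (w : ℂ) => (bc ν m : ℂ) * w ^ m)
    (U := ball 0 (‖w‖ + 1)) (z := w) (exp_summable (‖w‖ + 1)) (fun i => by fun_prop) isOpen_ball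
    (fun i z hz => (bc_term_bound ν hν z i).trans (by
      have : ‖z‖ ≤ ‖w‖ + 1 := by simpa using (mem_ball.1 hz).le
      gcongr)) (by simp)
  have h2 := (bg_diff ν hν w).hasDerivAt
  convert! h2 using 1
  change _ = deriv (fun w => ∑' m : ℕ, (bc ν m : ℂ) * w ^ m) w
  rw [← h1.tsum_eq, h1.summable.tsum_eq_zero_add]
  simp only [pow_zero, mul_one, deriv_const', zero_add]
  have p4 : (ν : ℂ) + 1 ≠ 0 := by exact_mod_cast (by positivity : ν + 1 ≠ 0)
  rw [bg, ← tsum_neg, ← tsum_div_const]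
  have h3 : deriv (fun w : ℂ => ((bc ν 0 : ℝ) : ℂ)) w = 0 := deriv_const _ _
  apply tsum_congr
  intro m
  have e1 := bc_shift ν hν m
  have e2 := bc_succ ν hν m
  have e3 : bc (ν + 1) m = - (bc ν (m + 1) * (m + 1)) * (ν + 1) := by
    have p : ν + m + 1 ≠ 0 := by positivity
    apply mul_right_cancel₀ p
    linear_combination e1 + (ν + 1) * e2
  rw [e3]
  have h4 : deriv (fun w : ℂ => (bc ν (m + 1) : ℂ) * w ^ (m + 1)) w
      = (bc ν (m + 1) : ℂ) * ((m + 1) * w ^ m) := by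
    simp
  rw [h4]
  push_cast
  field_simp

lemma bg_rec (ν : ℝ) (hν : 0 ≤ ν) (w : ℂ) :
    bg ν w = bg (ν + 1) w - w * bg (ν + 2) w / ((ν + 1) * (ν + 2)) := by
  have hc : ∀ m : ℕ, bc ν (m + 1) = bc (ν + 1) (m + 1) - bc (ν + 2) m / ((ν + 1) * (ν + 2)) := by
    intro m
    have e1 := bc_shift ν hν (m + 1)
    have e2 := bc_shift ν hν m
    have e3 := bc_shift (ν + 1) (by linarith) m
    have e4 := bc_succ ν hν m
    rw [show ν + 1 + 1 = ν + 2 by ring] at e3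
    push_cast at e1
    have p1 : ν + (m + 1) + 1 ≠ 0 := by positivity
    have p2 : ν + 1 + m + 1 ≠ 0 := by positivity
    have p3 : ν + m + 1 ≠ 0 := by positivity
    have p4 : ν + 1 ≠ 0 := by positivity
    have p5 : ν + 2 ≠ 0 := by positivity
    have f1 : bc (ν + 1) (m + 1) = bc ν (m + 1) * (ν + 1) / (ν + (m + 1) + 1) := by
      rw [eq_div_iff p1, e1]
    have f2 : bc (ν + 1) m = bc ν m * (ν + 1) / (ν + m + 1) := by
      rw [eq_div_iff p3, e2]
    have f3 : bc (ν + 2) m = bc (ν + 1) m * (ν + 2) / (ν + 1 + m + 1) := by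
      rw [eq_div_iff p2]; linear_combination e3
    have f4 : bc ν m = - (bc ν (m + 1) * ((m + 1) * (ν + m + 1))) := by linarith
    rw [f3, f2, f1, f4]
    field_simp
    ring
  have p4 : (ν : ℂ) + 1 ≠ 0 := by exact_mod_cast (by positivity : ν + 1 ≠ 0)
  have p5 : (ν : ℂ) + 2 ≠ 0 := by exact_mod_cast (by positivity : ν + 2 ≠ 0)
  have s1 := bg_summable (ν + 1) (by linarith) w
  have s2 := bg_summable (ν + 2) (by linarith) w
  have s0 := bg_summable ν hν w
  unfold bg
  rw [s0.tsum_eq_zero_add, s1.tsum_eq_zero_add, bc_zero ν hν, bc_zero (ν + 1) (by linarith),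
    mul_div_assoc, ← tsum_div_const, ← tsum_mul_left, add_sub_assoc,
    ← Summable.tsum_sub ((summable_nat_add_iff 1).2 s1) ((s2.div_const _).mul_left _)]
  congr 1
  apply tsum_congr
  intro m
  rw [hc m]
  push_cast
  field_simp
  ring

lemma bg_zero (ν : ℝ) (hν : 0 ≤ ν) : bg ν 0 = 1 := by
  unfold bg
  rw [tsum_eq_single 0]
  · simp [bc_zero ν hν]
  · intro m hm; simp [hm]

/-- The derivative of `bg`. -/
noncomputable def bd (ν : ℝ) (w : ℂ) : ℂ := -(bg (ν + 1) w) / (ν + 1)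

lemma bd_deriv (ν : ℝ) (hν : 0 ≤ ν) (w : ℂ) :
    HasDerivAt (bd ν) (bg (ν + 2) w / ((ν + 1) * (ν + 2))) w := by
  have h := ((bg_deriv (ν + 1) (by linarith) w).neg).div_const ((ν : ℂ) + 1)
  have p4 : (ν : ℂ) + 1 ≠ 0 := by exact_mod_cast (by positivity : ν + 1 ≠ 0)
  have p5 : (ν : ℂ) + 2 ≠ 0 := by exact_mod_cast (by positivity : ν + 2 ≠ 0)
  convert! h using 1
  rw [show ν + 1 + 1 = ν + 2 by ring]
  push_cast
  rw [show (ν : ℂ) + 1 + 1 = ν + 2 by ring]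
  field_simp

lemma bg_ode (ν : ℝ) (hν : 0 ≤ ν) (w : ℂ) :
    w * (bg (ν + 2) w / ((ν + 1) * (ν + 2))) + (ν + 1) * bd ν w + bg ν w = 0 := by
  have p4 : (ν : ℂ) + 1 ≠ 0 := by exact_mod_cast (by positivity : ν + 1 ≠ 0)
  have p5 : (ν : ℂ) + 2 ≠ 0 := by exact_mod_cast (by positivity : ν + 2 ≠ 0)
  rw [bg_rec ν hν w, bd]
  field_simp
  ring

lemma bg_conj (ν : ℝ) (x : ℝ) : (((bg ν x).re : ℝ) : ℂ) = bg ν x := by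
  have : bg ν x = ((∑' m : ℕ, bc ν m * x ^ m : ℝ) : ℂ) := by
    unfold bg
    push_cast
    rfl
  rw [this, Complex.ofReal_re]

lemma bg_re (ν : ℝ) (x : ℝ) : (bg ν x).re = ∑' m : ℕ, bc ν m * x ^ m := by
  have : bg ν x = ((∑' m : ℕ, bc ν m * x ^ m : ℝ) : ℂ) := by
    unfold bg
    push_cast
    rfl
  rw [this, Complex.ofReal_re]

lemma bd_conj (ν : ℝ) (x : ℝ) : (((bd ν x).re : ℝ) : ℂ) = bd ν x := by
  have : bd ν x = (((-(bg (ν + 1) x).re) / (ν + 1) : ℝ) : ℂ) := by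
    push_cast
    rw [bg_conj, bd]
  rw [this, Complex.ofReal_re]

lemma bg_hd (ν : ℝ) (hν : 0 ≤ ν) (w : ℂ) : HasDerivAt (bg ν) (bd ν w) w := bg_deriv ν hν w

lemma bg_real_deriv (ν : ℝ) (hν : 0 ≤ ν) (x : ℝ) :
    HasDerivAt (fun x : ℝ => (bg ν x).re) (bd ν x).re x :=
  (bg_hd ν hν x).real_of_complex

/-- Zeros are simple. -/
lemma bg_simple (ν : ℝ) (hν : 0 ≤ ν) (a : ℝ) (ha : 0 < a) (h0 : bg ν a = 0) : bd ν a ≠ 0 := by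
  intro h1
  set E : ℝ → ℝ := fun x => x * (bd ν x).re ^ 2 + (bg ν x).re ^ 2 with hE
  have hder : ∀ x : ℝ, HasDerivAt E (-(2 * ν + 1) * (bd ν x).re ^ 2) x := by
    intro x
    have d1 := bg_real_deriv ν hν x
    have d2 := (bd_deriv ν hν x).real_of_complex
    have d := ((hasDerivAt_id x).mul (d2.pow 2)).add (d1.pow 2)
    have ode := congrArg Complex.re (bg_ode ν hν x)
    simp only [Complex.add_re, Complex.zero_re, Complex.re_ofReal_mul] at ode
    have e2 : (((ν : ℂ) + 1) * bd ν x).re = (ν + 1) * (bd ν x).re := by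
      rw [show (ν : ℂ) + 1 = ((ν + 1 : ℝ) : ℂ) by push_cast; rfl, Complex.re_ofReal_mul]
    rw [e2] at ode
    convert! d using 1
    simp
    linear_combination (-2 * (bd ν x).re) * ode
  have hanti : Antitone E := antitone_of_hasDerivAt_nonpos hder (fun x => by
    have := sq_nonneg (bd ν x).re
    show -(2 * ν + 1) * (bd ν x).re ^ 2 ≤ 0
    nlinarith)
  have hEa : E a = 0 := by simp [hE, h0, h1]
  have hzero : ∀ x : ℝ, a ≤ x → bg ν x = 0 := by
    intro x hx
    have h2 := hanti hx
    rw [hEa] at h2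
    simp only [hE] at h2
    have h3 : 0 ≤ x * (bd ν x).re ^ 2 := mul_nonneg (by linarith) (sq_nonneg _)
    have h4 : (bg ν x).re = 0 := by
      have := sq_nonneg (bg ν x).re
      apply pow_eq_zero_iff (two_ne_zero) |>.1
      linarith
    rw [← bg_conj, h4]; simp
  have hinf := aux_finite (bg ν) (bg_diff ν hν) (bg_zero ν hν) (a + 1)
  have : (Icc a (a + 1)) ⊆ {b : ℝ | 0 < b ∧ b ≤ a + 1 ∧ bg ν b = 0} := by
    rintro b ⟨hb1, hb2⟩
    exact ⟨by linarith, hb2, hzero b hb1⟩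
  exact (Icc_infinite (by linarith : a < a + 1)) (hinf.subset this)

lemma bg_neg (ν : ℝ) (hν : 0 ≤ ν) (x : ℝ) (hx : x ≤ 0) : bg ν x ≠ 0 := by
  intro h
  have h1 : (bg ν x).re = 0 := by rw [h]; rfl
  rw [bg_re] at h1
  have hs : Summable (fun m : ℕ => bc ν m * x ^ m) := by
    have := bg_summable ν hν x
    exact_mod_cast this
  have hnn : ∀ m : ℕ, 0 ≤ bc ν m * x ^ m := by
    intro m
    have g1 : 0 < Real.Gamma (ν + m + 1) := Real.Gamma_pos_of_pos (by positivity)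
    have g0 : 0 < Real.Gamma (ν + 1) := Real.Gamma_pos_of_pos (by positivity)
    have : bc ν m * x ^ m = Real.Gamma (ν + 1) / (m.factorial * Real.Gamma (ν + m + 1)) * (-x) ^ m := by
      rw [neg_pow x, bc]; ring
    rw [this]
    have : 0 ≤ -x := by linarith
    positivity
  have := hs.le_tsum 0 (fun j _ => hnn j)
  rw [h1] at this
  simp [bc_zero ν hν] at this
  linarith

lemma bg_zero_real (ν : ℝ) (hν : 0 ≤ ν) (l : ℂ) (hl : bg ν l = 0) : ∃ a : ℝ, 0 < a ∧ l = a := by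
  have him : l.im = 0 := by
    by_contra him
    set u : ℝ → ℂ := fun t => bg ν (l * t) with hu
    set v : ℝ → ℂ := fun t => l * bd ν (l * t) with hv
    set v' : ℝ → ℂ := fun t => l * (l * (bg (ν + 2) (l * t) / ((ν + 1) * (ν + 2)))) with hv'
    have hlin : ∀ t : ℝ, HasDerivAt (fun t : ℝ => l * (t : ℂ)) l t := by
      intro t
      simpa using (Complex.ofRealCLM.hasDerivAt (x := t)).const_mul l
    have du : ∀ t, HasDerivAt u (v t) t := by
      intro t
      have := (bg_hd ν hν (l * t)).comp t (hlin t)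
      convert! this using 1
      simp only [hv]; ring
    have dv : ∀ t, HasDerivAt v (v' t) t := by
      intro t
      have := ((bd_deriv ν hν (l * t)).comp t (hlin t)).const_mul l
      convert! this using 1
      simp only [hv']; ring
    have ode : ∀ t : ℝ, t * v' t + (ν + 1) * v t + l * u t = 0 := by
      intro t
      have := bg_ode ν hν (l * t)
      simp only [hu, hv, hv']
      linear_combination l * this
    set Q : ℝ → ℝ := fun t => (v t * (starRingEnd ℂ) (u t)).im with hQ
    have dQ : ∀ t, HasDerivAt Q ((v' t * (starRingEnd ℂ) (u t)).im) t := by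
      intro t
      have h1 : HasDerivAt (fun t => (starRingEnd ℂ) (u t)) ((starRingEnd ℂ) (v t)) t :=
        (Complex.conjCLE.toContinuousLinearMap.hasFDerivAt.comp_hasDerivAt t (du t))
      have h2 := (dv t).mul h1
      have h3 := (Complex.imCLM.hasFDerivAt.comp_hasDerivAt t h2)
      convert! h3 using 1
      simp [Complex.mul_im]
      ring
    set K : ℝ → ℝ := fun t => l.im * (t ^ (ν + 1) * Q t) with hK
    have dK : ∀ t, 0 < t → HasDerivAt K (-(l.im ^ 2 * (t ^ ν * Complex.normSq (u t)))) t := by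
      intro t ht
      have h1 : HasDerivAt (fun t : ℝ => t ^ (ν + 1)) ((ν + 1) * t ^ ν) t := by
        have := Real.hasDerivAt_rpow_const (x := t) (p := ν + 1) (Or.inl ht.ne')
        simpa using this
      have h2 := (h1.mul (dQ t)).const_mul l.im
      convert! h2 using 1
      have hp : t ^ (ν + 1) = t ^ ν * t := by
        rw [Real.rpow_add ht, Real.rpow_one]
      have o := congrArg Complex.im (congrArg (fun z => z * (starRingEnd ℂ) (u t)) (ode t))
      have o2 : t * (v' t * (starRingEnd ℂ) (u t)).im + (ν + 1) * Q t
          + l.im * Complex.normSq (u t) = 0 := by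
        simp only [zero_mul, Complex.zero_im] at o
        rw [← o]
        simp [hQ, Complex.mul_im, Complex.mul_re, Complex.normSq_apply]
        ring
      rw [hp]
      linear_combination (l.im * t ^ ν) * (-o2)
    have hKc : Continuous K := by
      have c1 : Continuous Q := continuous_iff_continuousAt.2 fun t => (dQ t).continuousAt
      have c2 : Continuous (fun t : ℝ => t ^ (ν + 1)) :=
        Real.continuous_rpow_const (by linarith)
      exact continuous_const.mul (c2.mul c1)
    have hanti : AntitoneOn K (Icc 0 1) := by
      apply antitoneOn_of_deriv_nonpos (convex_Icc 0 1) hKc.continuousOn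
      · intro t ht
        rw [interior_Icc] at ht
        exact (dK t ht.1).differentiableAt.differentiableWithinAt
      · intro t ht
        rw [interior_Icc] at ht
        rw [(dK t ht.1).deriv]
        have : 0 ≤ t ^ ν := Real.rpow_nonneg ht.1.le _
        have := Complex.normSq_nonneg (u t)
        simp only [Left.neg_nonpos_iff]
        positivity
    have K0 : K 0 = 0 := by
      simp [hK, Real.zero_rpow (by linarith : ν + 1 ≠ 0)]
    have K1 : K 1 = 0 := by
      simp [hK, hQ, hu, hl]
    have Kz : ∀ t ∈ Icc (0 : ℝ) 1, K t = 0 := by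
      intro t ht
      have a1 := hanti (left_mem_Icc.2 zero_le_one) ht ht.1
      have a2 := hanti ht (right_mem_Icc.2 zero_le_one) ht.2
      rw [K0] at a1
      rw [K1] at a2
      linarith
    have uz : ∀ t ∈ Ioo (0 : ℝ) 1, u t = 0 := by
      intro t ht
      have e : K =ᶠ[𝓝 t] fun _ => 0 := by
        filter_upwards [isOpen_Ioo.mem_nhds ht] with s hs
        exact Kz s ⟨hs.1.le, hs.2.le⟩
      have h1 := (dK t ht.1).deriv
      rw [e.deriv_eq, deriv_const] at h1
      have h2 : 0 < t ^ ν := Real.rpow_pos_of_pos ht.1 _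
      have h3 : l.im ^ 2 ≠ 0 := pow_ne_zero 2 him
      have h4 : Complex.normSq (u t) = 0 := by
        have h5 := h1.symm
        simp only [neg_eq_zero, mul_eq_zero] at h5
        rcases h5 with h5 | h5 | h5
        · exact absurd h5 h3
        · exact absurd h5 h2.ne'
        · exact h5
      exact Complex.normSq_eq_zero.1 h4
    have hc : Tendsto u (𝓝[>] 0) (𝓝 (u 0)) := (du 0).continuousAt.mono_left nhdsWithin_le_nhds
    have hc2 : Tendsto u (𝓝[>] 0) (𝓝 0) := by
      apply tendsto_const_nhds.congr'
      filter_upwards [Ioo_mem_nhdsGT (zero_lt_one' ℝ)] with t ht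
      exact (uz t ht).symm
    have := tendsto_nhds_unique hc hc2
    simp [hu, bg_zero ν hν] at this
  have hlr : l = (l.re : ℂ) := by
    apply Complex.ext <;> simp [him]
  refine ⟨l.re, ?_, hlr⟩
  by_contra hneg
  exact bg_neg ν hν l.re (not_lt.1 hneg) (by rw [← hlr]; exact hl)

lemma phi2_eq (ν : ℝ) (z : ℝ) : phi2 ν z = z * (bg ν (((z / 2) ^ 2 : ℝ) : ℂ)).re := by
  rw [bg_re, phi2]
  congr 1
  apply tsum_congr
  intro m
  rw [bc, ← pow_mul]

lemma phi2_deriv (ν : ℝ) (hν : 0 ≤ ν) (z : ℝ) :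
    deriv (phi2 ν) z = (bg ν (((z / 2) ^ 2 : ℝ) : ℂ)).re
      + 2 * (z / 2) ^ 2 * (bd ν (((z / 2) ^ 2 : ℝ) : ℂ)).re := by
  have h0 : phi2 ν = fun z => z * (bg ν (((z / 2) ^ 2 : ℝ) : ℂ)).re := funext (phi2_eq ν)
  have h1 : HasDerivAt (fun z : ℝ => (z / 2) ^ 2) (z / 2) z := by
    have := ((hasDerivAt_id z).div_const 2).pow 2
    convert! this using 1
    simp
    ring
  have h2 : HasDerivAt (fun z : ℝ => (bg ν (((z / 2) ^ 2 : ℝ) : ℂ)).re)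
      ((bd ν (((z / 2) ^ 2 : ℝ) : ℂ)).re * (z / 2)) z :=
    HasDerivAt.comp (h₂ := fun y : ℝ => (bg ν y).re) z (bg_real_deriv ν hν ((z / 2) ^ 2)) h1
  have h3 := ((hasDerivAt_id z).mul h2).deriv
  rw [h0]
  refine h3.trans ?_
  simp only [id]
  ring

lemma besselJ_eq (ν : ℝ) (hν : 0 ≤ ν) (x : ℝ) (hx : 0 < x) :
    besselJ ν x = (x / 2) ^ ν / Real.Gamma (ν + 1) * (bg ν (((x / 2) ^ 2 : ℝ) : ℂ)).re := by
  rw [bg_re, besselJ, ← tsum_mul_left]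
  apply tsum_congr
  intro m
  have g0 : Real.Gamma (ν + 1) ≠ 0 := (Real.Gamma_pos_of_pos (by linarith)).ne'
  have h1 : (x / 2) ^ (2 * (m : ℝ) + ν) = ((x / 2) ^ 2) ^ m * (x / 2) ^ ν := by
    rw [Real.rpow_add (by positivity), ← pow_mul]
    congr 1
    rw [← Real.rpow_natCast]
    push_cast
    rfl
  rw [h1, bc, show (m : ℝ) + ν + 1 = ν + m + 1 by ring]
  field_simp

lemma mem_besselZeros (ν : ℝ) (hν : 0 ≤ ν) (x : ℝ) (hx : 0 < x) :
    x ∈ besselZeros ν ↔ bg ν (((x / 2) ^ 2 : ℝ) : ℂ) = 0 := by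
  have g0 : 0 < Real.Gamma (ν + 1) := Real.Gamma_pos_of_pos (by linarith)
  have p0 : 0 < (x / 2) ^ ν := Real.rpow_pos_of_pos (by positivity) _
  constructor
  · rintro ⟨-, h⟩
    rw [besselJ_eq ν hν x hx] at h
    rcases mul_eq_zero.1 h with h | h
    · exact absurd h (by positivity)
    · rw [← bg_conj, h]; simp
  · intro h
    refine ⟨hx, ?_⟩
    rw [besselJ_eq ν hν x hx, h]; simp

/-- Bijection between the positive zeros of `J_ν` and the zeros of `bg`. -/
noncomputable def zeroEquiv (ν : ℝ) (hν : 0 ≤ ν) :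
    besselZeros ν ≃ {a : ℝ // 0 < a ∧ bg ν a = 0} where
  toFun x := ⟨((x : ℝ) / 2) ^ 2, by have := x.2.1; positivity,
    (mem_besselZeros ν hν x x.2.1).1 x.2⟩
  invFun a := ⟨2 * √(a : ℝ), by
    have ha := a.2.1
    rw [mem_besselZeros ν hν _ (by positivity)]
    rw [mul_div_cancel_left₀ _ (by norm_num), Real.sq_sqrt ha.le]
    exact a.2.2⟩
  left_inv x := by
    have := x.2.1
    apply Subtype.ext
    simp only
    rw [Real.sqrt_sq (by positivity)]
    ring
  right_inv a := by
    have ha := a.2.1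
    apply Subtype.ext
    simp only
    rw [mul_div_cancel_left₀ _ (by norm_num), Real.sq_sqrt ha.le]

lemma bg_hasSum (ν : ℝ) (hν : 0 ≤ ν) (x : ℝ) (hx : 0 ≤ x)
    (hxz : ∀ a : ℝ, 0 < a → bg ν a = 0 → x < a) :
    HasSum (fun a : {a : ℝ // 0 < a ∧ bg ν a = 0} => 1 / ((a : ℝ) - x))
      (-((bd ν x).re / (bg ν x).re)) := by
  have h := aux_hasSum (bg ν) (bg_diff ν hν) (bg_zero ν hν) (bg_growth ν hν)
    (bg_zero_real ν hν) (fun w hw => by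
      obtain ⟨a, ha, rfl⟩ := bg_zero_real ν hν w hw
      rw [(bg_hd ν hν a).deriv]
      exact bg_simple ν hν a ha hw) x hx hxz
  rw [(bg_hd ν hν x).deriv, ← bg_conj, ← bd_conj, ← Complex.ofReal_div, Complex.ofReal_re] at h
  exact h

/-- For all sufficiently large `ν ≥ 0`: the derivative `ϕ_ν'` has a smallest positive
zero `R`, `R < x` for every positive zero `x` of `J_ν`, and
`Σ_{k=1}^∞ R^{2k} σ_k(ν)` converges with sum `1/2`. -/
theorem phi2_deriv_smallest_zero_rayleigh_series :
    ∃ ν₀ : ℝ, 0 ≤ ν₀ ∧ ∀ ν : ℝ, ν₀ ≤ ν →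
      ∃ R : ℝ, IsLeast {x : ℝ | 0 < x ∧ deriv (phi2 ν) x = 0} R ∧
        (∀ x ∈ besselZeros ν, R < x) ∧
        Summable (fun k : ℕ => R ^ (2 * (k + 1)) * rayleigh (k + 1) ν) ∧
        ∑' k : ℕ, R ^ (2 * (k + 1)) * rayleigh (k + 1) ν = 1 / 2 := by
  refine ⟨0, le_rfl, fun ν hν => ?_⟩
  -- a smallest zero of `bg`
  have hne : ∃ a : ℝ, 0 < a ∧ bg ν a = 0 := by
    by_contra hno
    push Not at hno
    have h := bg_hasSum ν hν 0 le_rfl (fun a h1 h2 => absurd h2 (hno a h1))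
    have : IsEmpty {a : ℝ // 0 < a ∧ bg ν a = 0} := ⟨fun a => hno a a.2.1 a.2.2⟩
    have h2 := h.unique hasSum_empty
    have h3 : bd ν ((0 : ℝ) : ℂ) = ((-1 / (ν + 1) : ℝ) : ℂ) := by
      rw [Complex.ofReal_zero, bd, bg_zero (ν + 1) (by linarith)]
      push_cast
      rfl
    rw [h3, Complex.ofReal_zero, bg_zero ν hν, Complex.ofReal_re] at h2
    have : ν + 1 ≠ 0 := by positivity
    simp at h2
    exact this h2
  obtain ⟨a₁, ha₁, hga₁, hmin⟩ : ∃ a₁ : ℝ, 0 < a₁ ∧ bg ν a₁ = 0 ∧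
      ∀ a : ℝ, 0 < a → bg ν a = 0 → a₁ ≤ a := by
    obtain ⟨b, hb, hgb⟩ := hne
    obtain ⟨a, ⟨h1, h2, h3⟩, h4⟩ := Set.exists_min_image _ id
      (aux_finite (bg ν) (bg_diff ν hν) (bg_zero ν hν) b) ⟨b, hb, le_rfl, hgb⟩
    refine ⟨a, h1, h3, fun c hc hgc => ?_⟩
    rcases le_total c b with h | h
    · exact h4 c ⟨hc, h, hgc⟩
    · exact h2.trans h
  have hGc : Continuous (fun x : ℝ => (bg ν x).re) :=
    continuous_iff_continuousAt.2 fun x => (bg_real_deriv ν hν x).continuousAt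
  have hDc : Continuous (fun x : ℝ => (bd ν x).re) :=
    continuous_iff_continuousAt.2 fun x => ((bd_deriv ν hν x).real_of_complex).continuousAt
  have hGpos : ∀ x : ℝ, 0 ≤ x → x < a₁ → 0 < (bg ν x).re := by
    intro x hx0 hx1
    by_contra hcon
    have h1 : (0 : ℝ) ∈ Icc ((bg ν x).re) ((bg ν ((0 : ℝ) : ℂ)).re) := by
      refine ⟨not_lt.1 hcon, ?_⟩
      simp [bg_zero ν hν]
    obtain ⟨y, hy, hy2⟩ := intermediate_value_Icc' hx0 hGc.continuousOn h1
    have hy3 : bg ν y = 0 := by rw [← bg_conj]; simp only at hy2; rw [hy2]; simp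
    rcases hy.1.eq_or_lt with h | h
    · rw [← h, Complex.ofReal_zero, bg_zero ν hν] at hy3
      exact one_ne_zero hy3
    · have := hmin y h hy3
      linarith [hy.2]
  set F : ℝ → ℝ := fun w => (bg ν w).re + 2 * w * (bd ν w).re with hF
  have hFc : Continuous F := hGc.add ((continuous_const.mul continuous_id).mul hDc)
  have hF0 : F 0 = 1 := by simp [hF, bg_zero ν hν]
  have hF1 : F (a₁ / 3) ≤ 0 := by
    have h := bg_hasSum ν hν (a₁ / 3) (by positivity)
      (fun a h1 h2 => by linarith [hmin a h1 h2])
    have h1 := le_hasSum h ⟨a₁, ha₁, hga₁⟩ (fun b _ => by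
      have := hmin b b.2.1 b.2.2
      apply div_nonneg zero_le_one
      linarith)
    have hG := hGpos (a₁ / 3) (by positivity) (by linarith)
    simp only [hF]
    simp only at h1
    rw [← neg_div, le_div_iff₀ hG] at h1
    have h2 : 1 / (a₁ - a₁ / 3) = 3 / (2 * a₁) := by
      rw [div_eq_div_iff (by linarith) (by positivity)]
      ring
    rw [h2] at h1
    have h3 : 2 * (a₁ / 3) * (3 / (2 * a₁) * (bg ν ((a₁ / 3 : ℝ) : ℂ)).re)
        ≤ 2 * (a₁ / 3) * -(bd ν ((a₁ / 3 : ℝ) : ℂ)).re := by gcongr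
    have h4 : 2 * (a₁ / 3) * (3 / (2 * a₁) * (bg ν ((a₁ / 3 : ℝ) : ℂ)).re)
        = (bg ν ((a₁ / 3 : ℝ) : ℂ)).re := by
      field_simp
    linarith
  obtain ⟨w₀, ⟨hw₀, hFw⟩, hwmin⟩ : ∃ w₀, IsLeast (Icc 0 (a₁ / 3) ∩ {w | F w = 0}) w₀ := by
    apply IsCompact.exists_isLeast
    · exact isCompact_Icc.inter_right (isClosed_eq hFc continuous_const)
    · obtain ⟨y, hy, hy2⟩ := intermediate_value_Icc' (by positivity : (0 : ℝ) ≤ a₁ / 3)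
        hFc.continuousOn (show (0 : ℝ) ∈ Icc (F (a₁ / 3)) (F 0) from ⟨hF1, by rw [hF0]; norm_num⟩)
      exact ⟨y, hy, hy2⟩
  have hFw' : F w₀ = 0 := hFw
  have hwpos : 0 < w₀ := by
    rcases hw₀.1.eq_or_lt with h | h
    · rw [← h, hF0] at hFw'
      norm_num at hFw'
    · exact h
  have hwa : w₀ < a₁ := by linarith [hw₀.2]
  set R := 2 * √w₀ with hR
  have hRpos : 0 < R := by positivity
  have hRw : (R / 2) ^ 2 = w₀ := by
    rw [hR, mul_div_cancel_left₀ _ (by norm_num), Real.sq_sqrt hwpos.le]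
  have hRx : ∀ x ∈ besselZeros ν, w₀ < (x / 2) ^ 2 := by
    intro x hx
    have h1 := (mem_besselZeros ν hν x hx.1).1 hx
    have := hmin _ (by have := hx.1; positivity) h1
    linarith
  refine ⟨R, ⟨⟨hRpos, ?_⟩, ?_⟩, ?_, ?_⟩
  · rw [phi2_deriv ν hν, hRw]
    exact hFw'
  · rintro x ⟨hx, hx2⟩
    rw [phi2_deriv ν hν] at hx2
    by_contra hlt
    have hlt' : (x / 2) ^ 2 < w₀ := by
      rw [← hRw]
      have := not_le.1 hlt
      gcongr
    have := hwmin ⟨⟨by positivity, by linarith [hw₀.2]⟩, hx2⟩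
    linarith
  · intro x hx
    have h1 := hRx x hx
    rw [← hRw] at h1
    have := lt_of_pow_lt_pow_left₀ 2 (by have := hx.1; positivity) h1
    linarith
  · have hG := hGpos w₀ hwpos.le hwa
    have h := (bg_hasSum ν hν w₀ hwpos.le (fun a h1 h2 => hwa.trans_le (hmin a h1 h2))).mul_left w₀
    have hval : w₀ * -((bd ν w₀).re / (bg ν w₀).re) = 1 / 2 := by
      simp only [hF] at hFw'
      field_simp
      linarith
    rw [hval] at h
    have h' := (zeroEquiv ν hν).hasSum_iff.2 h
    set f : besselZeros ν × ℕ → ℝ := fun p => (R ^ 2 / (p.1 : ℝ) ^ 2) ^ (p.2 + 1) with hf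
    have hgeo : ∀ x : besselZeros ν,
        HasSum (fun k : ℕ => f (x, k)) (w₀ * (1 / (((x : ℝ) / 2) ^ 2 - w₀))) := by
      intro x
      have hx := x.2.1
      have h1 := hRx x x.2
      have hρ0 : 0 ≤ R ^ 2 / (x : ℝ) ^ 2 := by positivity
      have hR2 : R ^ 2 = 4 * w₀ := by rw [← hRw]; ring
      have hρ1 : R ^ 2 / (x : ℝ) ^ 2 < 1 := by
        rw [div_lt_one (by positivity), hR2]
        nlinarith
      have h2 := (hasSum_geometric_of_lt_one hρ0 hρ1).mul_left (R ^ 2 / (x : ℝ) ^ 2)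
      convert! h2 using 1
      · funext k
        simp only [hf]
        ring
      · rw [hR2] at hρ1 ⊢
        have e1 : ((x : ℝ) / 2) ^ 2 - w₀ ≠ 0 := by linarith
        have e2 : 1 - 4 * w₀ / (x : ℝ) ^ 2 ≠ 0 := by linarith
        rw [← div_eq_mul_inv, mul_one_div, div_eq_div_iff e1 e2]
        field_simp
        ring
    have hfn : 0 ≤ f := fun p => by
      have := p.1.2.1
      simp only [hf, Pi.zero_apply]
      positivity
    have hfs : Summable f := by
      rw [summable_prod_of_nonneg hfn]
      refine ⟨fun x => (hgeo x).summable, ?_⟩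
      simp_rw [fun x => (hgeo x).tsum_eq]
      exact h'.summable
    have hterm : ∀ k : ℕ, R ^ (2 * (k + 1)) * rayleigh (k + 1) ν = ∑' x, f (x, k) := by
      intro k
      rw [rayleigh, ← tsum_mul_left]
      apply tsum_congr
      intro x
      simp only [hf]
      rw [div_pow, ← pow_mul, ← pow_mul, div_eq_mul_inv]
    simp_rw [hterm]
    have hfs2 : Summable (fun p : ℕ × besselZeros ν => f (p.2, p.1)) := hfs.prod_symm
    refine ⟨hfs2.prod, ?_⟩
    rw [hfs.tsum_comm (f := fun x k => f (x, k))]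
    simp_rw [fun x => (hgeo x).tsum_eq]
    exact h'.tsum_eq
end

section
/- Let ν ≥ 0 and let s be the smallest positive zero of φ_ν′. Then the series Σ_{x ∈ Z_ν} 1/(x² − s) converges and 1/s = Σ_{x ∈ Z_ν} 1/(x² − s). -/
/-- The normalised Bessel function
`φ_ν(z) = z Σ_{m=0}^∞ ((-1)^m Γ(ν+1)/(4^m m! Γ(ν+m+1))) z^m`
(equal to `2^ν Γ(ν+1) z^{1-ν/2} J_ν(√z)` for `z > 0`). -/
noncomputable def phi (ν : ℝ) (z : ℝ) : ℝ :=
  z * ∑' m : ℕ, ((-1 : ℝ) ^ m * Real.Gamma (ν + 1) /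
    (4 ^ m * m.factorial * Real.Gamma (ν + m + 1))) * z ^ m

namespace BesselAux

/-- The general term of the regularised series. -/
noncomputable def tm (μ z : ℝ) (m : ℕ) : ℝ :=
  (-(z / 4)) ^ m / (m.factorial * Real.Gamma (μ + m + 1))

/-- `F μ z = Σ (-z/4)^m / (m! Γ(μ+m+1))`. -/
noncomputable def F (μ z : ℝ) : ℝ := ∑' m : ℕ, tm μ z m

lemma gamma_pos (μ : ℝ) (hμ : 0 ≤ μ) (m : ℕ) : 0 < Real.Gamma (μ + m + 1) :=
  Real.Gamma_pos_of_pos (by positivity)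

lemma gamma_ge (μ : ℝ) (hμ : 0 ≤ μ) (m : ℕ) :
    Real.Gamma (μ + 1) * m.factorial ≤ Real.Gamma (μ + m + 1) := by
  induction m with
  | zero => simp
  | succ m ih =>
    have h1 : Real.Gamma (μ + (m + 1 : ℕ) + 1) = (μ + m + 1) * Real.Gamma (μ + m + 1) := by
      rw [← Real.Gamma_add_one (by positivity)]
      congr 1; push_cast; ring
    rw [h1, Nat.factorial_succ]
    push_cast
    have h2 : ((m : ℝ) + 1) ≤ μ + m + 1 := by linarith
    calc Real.Gamma (μ + 1) * (((m : ℝ) + 1) * m.factorial)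
        = ((m : ℝ) + 1) * (Real.Gamma (μ + 1) * m.factorial) := by ring
      _ ≤ (μ + m + 1) * Real.Gamma (μ + m + 1) :=
        mul_le_mul h2 ih (by have := gamma_pos μ hμ 0; simp at this; positivity) (by positivity)

lemma gamma_ge' (μ : ℝ) (hμ : 0 ≤ μ) (m : ℕ) :
    Real.Gamma (μ + 1) ≤ Real.Gamma (μ + m + 1) := by
  refine le_trans ?_ (gamma_ge μ hμ m)
  have := gamma_pos μ hμ 0
  simp at this
  have h2 : (1 : ℝ) ≤ m.factorial := by exact_mod_cast Nat.one_le_iff_ne_zero.mpr (Nat.factorial_ne_zero m)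
  nlinarith

lemma gamma_pos1 (μ : ℝ) (hμ : 0 ≤ μ) : 0 < Real.Gamma (μ + 1) :=
  Real.Gamma_pos_of_pos (by positivity)

lemma tm_le (μ z M : ℝ) (hμ : 0 ≤ μ) (hM : |z| ≤ M) (m : ℕ) :
    ‖tm μ z m‖ ≤ ((M / 4) ^ m / m.factorial) / Real.Gamma (μ + 1) := by
  have h0 := gamma_pos1 μ hμ
  have h1 := gamma_ge' μ hμ m
  have h2 := gamma_pos μ hμ m
  have hf : (0 : ℝ) < m.factorial := by positivity
  have hM0 : 0 ≤ M := (abs_nonneg z).trans hM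
  unfold tm
  rw [norm_div, norm_pow, norm_neg, norm_div, norm_mul, Real.norm_eq_abs z, div_div]
  rw [Real.norm_of_nonneg hf.le, Real.norm_of_nonneg h2.le, Real.norm_of_nonneg (by norm_num : (0:ℝ) ≤ 4)]
  gcongr

lemma summable_bd (M C : ℝ) : Summable (fun m : ℕ => ((M / 4) ^ m / m.factorial) / C) :=
  (Real.summable_pow_div_factorial (M / 4)).div_const C

lemma summable_tm (μ z : ℝ) (hμ : 0 ≤ μ) : Summable (tm μ z) :=
  Summable.of_norm_bounded (summable_bd |z| _) (tm_le μ z |z| hμ le_rfl)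

lemma tsum_bd (M C : ℝ) : ∑' m : ℕ, ((M / 4) ^ m / m.factorial) / C = Real.exp (M / 4) / C := by
  rw [tsum_div_const, Real.exp_eq_exp_ℝ, NormedSpace.exp_eq_tsum_div]

lemma abs_F_le (μ z M : ℝ) (hμ : 0 ≤ μ) (hM : |z| ≤ M) :
    |F μ z| ≤ Real.exp (M / 4) / Real.Gamma (μ + 1) := by
  rw [← tsum_bd, ← Real.norm_eq_abs]
  exact tsum_of_norm_bounded (summable_bd M _).hasSum (tm_le μ z M hμ hM)

lemma tm_succ (μ z : ℝ) (m : ℕ) :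
    ((m : ℝ) + 1) * tm μ z (m + 1) = -(z / 4) * tm (μ + 1) z m := by
  unfold tm
  rw [Nat.factorial_succ]
  have : μ + ((m + 1 : ℕ) : ℝ) + 1 = μ + 1 + m + 1 := by push_cast; ring
  rw [this]
  have hf : (m.factorial : ℝ) ≠ 0 := by positivity
  have hm : ((m : ℝ) + 1) ≠ 0 := by positivity
  push_cast
  rw [pow_succ]
  field_simp

lemma F_rec (μ z : ℝ) (hμ : 0 ≤ μ) :
    F μ z = (μ + 1) * F (μ + 1) z - (z / 4) * F (μ + 2) z := by
  have e : ∀ m : ℕ, tm μ z m = (μ + 1) * tm (μ + 1) z m + (m : ℝ) * tm (μ + 1) z m := by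
    intro m
    unfold tm
    have h : Real.Gamma (μ + 1 + m + 1) = (μ + m + 1) * Real.Gamma (μ + m + 1) := by
      rw [← Real.Gamma_add_one (by positivity)]
      congr 1; ring
    rw [h]
    have h2 := (gamma_pos μ hμ m).ne'
    have h3 : (μ + m + 1) ≠ 0 := by positivity
    have hf : (m.factorial : ℝ) ≠ 0 := by positivity
    field_simp
    ring
  have s1 := (summable_tm (μ + 1) z (by positivity)).mul_left (μ + 1)
  have s2 : Summable (fun m : ℕ => (m : ℝ) * tm (μ + 1) z m) := by
    have : (fun m : ℕ => (m : ℝ) * tm (μ + 1) z m) = fun m => tm μ z m - (μ + 1) * tm (μ + 1) z m := by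
      ext m; rw [e m]; ring
    rw [this]
    exact (summable_tm μ z hμ).sub s1
  have e2 : ∑' m : ℕ, (m : ℝ) * tm (μ + 1) z m = -(z / 4) * F (μ + 2) z := by
    rw [s2.tsum_eq_zero_add]
    simp only [Nat.cast_zero, zero_mul, zero_add]
    unfold F
    rw [← tsum_mul_left]
    refine tsum_congr fun m => ?_
    have := tm_succ (μ + 1) z m
    push_cast
    rw [this]
    congr 2; ring
  unfold F at *
  rw [tsum_congr e, s1.tsum_add s2, tsum_mul_left, e2]
  ring

lemma F_hasDerivAt (μ z : ℝ) (hμ : 0 ≤ μ) :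
    HasDerivAt (F μ) (-(F (μ + 1) z) / 4) z := by
  set M := |z| + 1 with hM
  have hmem : ∀ y, y ∈ Metric.ball (0 : ℝ) M → |y| ≤ M := by
    intro y hy; simpa using (mem_ball_zero_iff.mp hy).le
  have key : ∀ (n : ℕ) (y : ℝ), HasDerivAt (fun w => tm μ w n)
      ((n : ℝ) * (-(y/4)) ^ (n - 1) * (-(1/4)) / (n.factorial * Real.Gamma (μ + n + 1))) y := by
    intro n y
    unfold tm
    refine HasDerivAt.div_const ?_ _
    have h1 : HasDerivAt (fun w : ℝ => -(w / 4)) (-(1/4)) y := ((hasDerivAt_id y).div_const 4).neg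
    exact h1.pow n
  have keq : ∀ (n : ℕ) (y : ℝ), ((n : ℝ) * (-(y/4)) ^ (n - 1) * (-(1/4)) / (n.factorial * Real.Gamma (μ + n + 1)))
     = if n = 0 then 0 else (-1/4) * tm (μ + 1) y (n - 1) := by
    intro n y
    rcases n with _ | n
    · simp
    · simp only [Nat.add_sub_cancel, Nat.succ_ne_zero, if_false]
      unfold tm
      rw [Nat.factorial_succ]
      have : μ + ((n + 1 : ℕ) : ℝ) + 1 = μ + 1 + n + 1 := by push_cast; ring
      rw [this]
      have hf : (n.factorial : ℝ) ≠ 0 := by positivity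
      have hm : ((n : ℝ) + 1) ≠ 0 := by positivity
      push_cast
      field_simp
  simp only [keq] at key
  let u : ℕ → ℝ := fun n => if n = 0 then 0 else (((M / 4) ^ (n-1) / (n-1).factorial) / Real.Gamma (μ + 1 + 1))
  have hu : Summable u := by
    rw [← summable_nat_add_iff 1]
    simpa [u] using summable_bd M (Real.Gamma (μ + 1 + 1))
  have h := hasDerivAt_tsum_of_isPreconnected (u := u) (t := Metric.ball (0 : ℝ) M) hu Metric.isOpen_ball
    (convex_ball _ _).isPreconnected (fun n y _ => key n y) (y₀ := z) (y := z) ?_ ?_ ?_ ?_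
  · have e : (∑' n : ℕ, if n = 0 then 0 else (-1/4) * tm (μ + 1) z (n - 1)) = -(F (μ + 1) z) / 4 := by
      rw [Summable.tsum_eq_zero_add]
      · simp only [if_true, Nat.succ_ne_zero, if_false, Nat.add_sub_cancel, zero_add]
        rw [tsum_mul_left]; unfold F; ring
      · rw [← summable_nat_add_iff 1]
        simpa using (summable_tm (μ + 1) z (by positivity)).mul_left (-1/4)
    rw [← e]
    exact h
  · intro n y hy
    rcases n with _ | n
    · simp [u]
    · simp only [Nat.succ_ne_zero, if_false, Nat.add_sub_cancel, u]
      have := tm_le (μ + 1) y M (by positivity) (hmem y hy) n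
      rw [norm_mul]
      refine le_trans ?_ this
      have h4 : ‖(-1/4 : ℝ)‖ ≤ 1 := by norm_num
      nlinarith [norm_nonneg (tm (μ+1) y n)]
  · simp [hM]
  · exact summable_tm μ z hμ
  · simp [hM]

lemma F_zero_bd (μ z : ℝ) (hμ : 0 ≤ μ) (h : F μ z = 0) : μ + 1 ≤ |z| / 4 * Real.exp (|z| / 4) := by
  have hs := summable_tm μ z hμ
  have h1 : F μ z = 1 / Real.Gamma (μ + 1) + ∑' m : ℕ, tm μ z (m + 1) := by
    unfold F
    rw [hs.tsum_eq_zero_add]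
    simp [tm]
  have h2 : ‖∑' m : ℕ, tm μ z (m + 1)‖ ≤ |z| / 4 * (Real.exp (|z| / 4) / Real.Gamma (μ + 1 + 1)) := by
    rw [← tsum_bd]
    refine tsum_of_norm_bounded ((summable_bd |z| _).hasSum.mul_left _) fun m => ?_
    have h3 := tm_succ μ z m
    have h4 := tm_le (μ + 1) z |z| (by positivity) le_rfl m
    have h5 : ((m : ℝ) + 1) * ‖tm μ z (m + 1)‖ = |z| / 4 * ‖tm (μ + 1) z m‖ := by
      have := congrArg norm h3
      rw [norm_mul, norm_mul, norm_neg, norm_div, Real.norm_of_nonneg (by positivity : (0:ℝ) ≤ (m:ℝ)+1)] at this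
      simpa using this
    have h6 : ‖tm μ z (m + 1)‖ ≤ ((m : ℝ) + 1) * ‖tm μ z (m + 1)‖ := by
      nlinarith [norm_nonneg (tm μ z (m + 1)), (Nat.cast_nonneg m : (0:ℝ) ≤ m)]
    rw [h5] at h6
    refine h6.trans ?_
    gcongr
  rw [h] at h1
  have h3 : ∑' m : ℕ, tm μ z (m + 1) = - (1 / Real.Gamma (μ + 1)) := by linarith
  have g0 := gamma_pos1 μ hμ
  rw [h3, norm_neg, Real.norm_of_nonneg (by positivity), Real.Gamma_add_one (by positivity : μ + 1 ≠ 0)] at h2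
  have : |z| / 4 * (Real.exp (|z| / 4) / ((μ + 1) * Real.Gamma (μ + 1))) = (|z| / 4 * Real.exp (|z| / 4) / (μ + 1)) / Real.Gamma (μ + 1) := by
    field_simp
  rw [this, div_le_div_iff_of_pos_right g0, one_le_div (by positivity)] at h2
  exact h2

lemma F_not_both (μ z : ℝ) (hμ : 0 ≤ μ) (hz : z ≠ 0) (h0 : F μ z = 0) (h1 : F (μ + 1) z = 0) : False := by
  have all : ∀ n : ℕ, F (μ + n) z = 0 ∧ F (μ + n + 1) z = 0 := by
    intro n
    induction n with
    | zero => simp [h0, h1]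
    | succ n ih =>
      have := F_rec (μ + n) z (by positivity)
      rw [ih.1, ih.2] at this
      push_cast
      refine ⟨by rw [← add_assoc]; exact ih.2, ?_⟩
      have h : F (μ + n + 2) z = 0 := by
        have : z / 4 * F (μ + n + 2) z = 0 := by linarith
        rcases mul_eq_zero.mp this with h | h
        · exact absurd h (by simpa using hz)
        · exact h
      rw [← h]; congr 1; ring
  obtain ⟨n, hn⟩ := exists_nat_gt (|z| / 4 * Real.exp (|z| / 4))
  have := F_zero_bd (μ + n) z (by positivity) (all n).1
  linarith

lemma bessel_eq (ν x : ℝ) (hx : 0 < x) : besselJ ν x = (x / 2) ^ ν * F ν (x ^ 2) := by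
  unfold besselJ F
  rw [← tsum_mul_left]
  refine tsum_congr fun m => ?_
  rw [Real.rpow_add (by positivity), Real.rpow_mul (by positivity), Real.rpow_natCast]
  unfold tm
  have : -(x ^ 2 / 4) = (-1) * (x / 2) ^ (2 : ℝ) := by
    rw [Real.rpow_ofNat]; ring
  rw [this, mul_pow, show (m : ℝ) + ν + 1 = ν + m + 1 by ring]
  ring

lemma phi_eq (ν : ℝ) : phi ν = fun z => z * (Real.Gamma (ν + 1) * F ν z) := by
  ext z
  unfold phi F
  congr 1
  rw [← tsum_mul_left]
  refine tsum_congr fun m => ?_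
  unfold tm
  rw [show -(z / 4) = (-1) * z / 4 by ring, div_pow, mul_pow]
  rw [mul_assoc ((4:ℝ)^m), div_div]
  field_simp

lemma mem_zeros (ν x : ℝ) : x ∈ besselZeros ν ↔ 0 < x ∧ F ν (x ^ 2) = 0 := by
  unfold besselZeros
  simp only [Set.mem_ofPred_eq]
  refine and_congr_right fun hx => ?_
  rw [bessel_eq ν x hx]
  have : (x / 2) ^ ν ≠ 0 := (Real.rpow_pos_of_pos (by positivity) _).ne'
  simp [this]

/-- The Hilbert space of square-summable sequences. -/
abbrev H := lp (fun _ : ℕ => ℝ) 2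

noncomputable def av (ν : ℝ) (n : ℕ) : ℝ := ν + 1 + 2 * n
noncomputable def qv (ν : ℝ) (n : ℕ) : ℝ := Real.sqrt (av ν n)
noncomputable def pv (ν : ℝ) (n : ℕ) : ℝ := Real.sqrt (av ν n + 1)
noncomputable def ev (n : ℕ) : H := lp.single 2 n (1 : ℝ)
noncomputable def bv (ν : ℝ) (n : ℕ) : H :=
  (pv ν n)⁻¹ • ((qv ν n)⁻¹ • ev n + (qv ν (n + 1))⁻¹ • ev (n + 1))

lemma av_ge (ν : ℝ) (hν : 0 ≤ ν) (n : ℕ) : (n : ℝ) + 1 ≤ av ν n := by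
  unfold av
  have : (0 : ℝ) ≤ n := Nat.cast_nonneg n
  linarith

lemma av_pos (ν : ℝ) (hν : 0 ≤ ν) (n : ℕ) : 0 < av ν n :=
  lt_of_lt_of_le (by positivity) (av_ge ν hν n)

lemma qv_pos (ν : ℝ) (hν : 0 ≤ ν) (n : ℕ) : 0 < qv ν n := Real.sqrt_pos.mpr (av_pos ν hν n)
lemma pv_pos (ν : ℝ) (hν : 0 ≤ ν) (n : ℕ) : 0 < pv ν n :=
  Real.sqrt_pos.mpr (by have := av_pos ν hν n; linarith)
lemma qv_sq (ν : ℝ) (hν : 0 ≤ ν) (n : ℕ) : qv ν n * qv ν n = av ν n :=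
  Real.mul_self_sqrt (av_pos ν hν n).le
lemma pv_sq (ν : ℝ) (hν : 0 ≤ ν) (n : ℕ) : pv ν n * pv ν n = av ν n + 1 :=
  Real.mul_self_sqrt (by have := av_pos ν hν n; linarith)

lemma inner_ev (n : ℕ) (x : H) : inner ℝ (ev n) x = x n := by
  unfold ev
  rw [lp.inner_single_left]
  simp

lemma ev_apply (n m : ℕ) : ev n m = if m = n then 1 else 0 := by
  unfold ev
  rw [lp.single_apply, Pi.single_apply]

lemma inner_bv (ν : ℝ) (n : ℕ) (x : H) :
    inner ℝ (bv ν n) x = (pv ν n)⁻¹ * ((qv ν n)⁻¹ * x n + (qv ν (n + 1))⁻¹ * x (n + 1)) := by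
  unfold bv
  rw [real_inner_smul_left, inner_add_left, real_inner_smul_left, real_inner_smul_left,
    inner_ev, inner_ev]

lemma norm_ev (n : ℕ) : ‖ev n‖ = 1 := by
  have h : ‖ev n‖ ^ 2 = 1 := by
    rw [← real_inner_self_eq_norm_sq, inner_ev, ev_apply]; simp
  nlinarith [norm_nonneg (ev n), sq_nonneg (‖ev n‖ - 1)]

lemma norm_bv (ν : ℝ) (hν : 0 ≤ ν) (n : ℕ) : ‖bv ν n‖ ≤ 2 / ((n : ℝ) + 1) := by
  have hr : 0 < Real.sqrt ((n : ℝ) + 1) := Real.sqrt_pos.mpr (by positivity)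
  have hp : Real.sqrt ((n : ℝ) + 1) ≤ pv ν n :=
    Real.sqrt_le_sqrt (by have := av_ge ν hν n; linarith)
  have hq : Real.sqrt ((n : ℝ) + 1) ≤ qv ν n := Real.sqrt_le_sqrt (av_ge ν hν n)
  have hq' : Real.sqrt ((n : ℝ) + 1) ≤ qv ν (n + 1) :=
    Real.sqrt_le_sqrt (by have := av_ge ν hν (n + 1); push_cast at this; linarith)
  have p0 := pv_pos ν hν n
  have q0 := qv_pos ν hν n
  have q1 := qv_pos ν hν (n + 1)
  unfold bv
  rw [norm_smul]
  have h1 : ‖(qv ν n)⁻¹ • ev n + (qv ν (n + 1))⁻¹ • ev (n + 1)‖ ≤ (qv ν n)⁻¹ + (qv ν (n + 1))⁻¹ := by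
    refine (norm_add_le _ _).trans ?_
    rw [norm_smul, norm_smul, norm_ev, norm_ev, Real.norm_of_nonneg (by positivity),
      Real.norm_of_nonneg (by positivity)]
    simp
  rw [Real.norm_of_nonneg (by positivity)]
  calc (pv ν n)⁻¹ * ‖(qv ν n)⁻¹ • ev n + (qv ν (n + 1))⁻¹ • ev (n + 1)‖
      ≤ (Real.sqrt ((n : ℝ) + 1))⁻¹ * ((Real.sqrt ((n : ℝ) + 1))⁻¹ + (Real.sqrt ((n : ℝ) + 1))⁻¹) := by
        refine mul_le_mul (inv_anti₀ hr hp) (h1.trans ?_) (norm_nonneg _) (by positivity)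
        exact add_le_add (inv_anti₀ hr hq) (inv_anti₀ hr hq')
    _ = 2 / (Real.sqrt ((n : ℝ) + 1) * Real.sqrt ((n : ℝ) + 1)) := by field_simp; norm_num
    _ = _ := by rw [Real.mul_self_sqrt (by positivity)]

lemma summable_rank (ν : ℝ) (hν : 0 ≤ ν) :
    Summable (fun n => InnerProductSpace.rankOne ℝ (bv ν n) (bv ν n)) := by
  refine Summable.of_norm_bounded (g := fun n : ℕ => 4 * (1 / ((n : ℝ) + 1) ^ 2)) ?_ ?_
  · refine Summable.mul_left _ ?_
    have := (summable_nat_add_iff 1).mpr (Real.summable_one_div_nat_pow.mpr (one_lt_two))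
    simpa using this
  · intro n
    rw [InnerProductSpace.norm_rankOne]
    have := norm_bv ν hν n
    calc ‖bv ν n‖ * ‖bv ν n‖ ≤ (2 / ((n : ℝ) + 1)) * (2 / ((n : ℝ) + 1)) := by gcongr
      _ = _ := by field_simp; norm_num

/-- The positive compact operator whose eigenvalues are `4 / λ`. -/
noncomputable def T (ν : ℝ) : H →L[ℝ] H :=
  ∑' n, InnerProductSpace.rankOne ℝ (bv ν n) (bv ν n)

lemma T_compact (ν : ℝ) (hν : 0 ≤ ν) : IsCompactOperator (T ν) := by
  refine isCompactOperator_of_tendsto (summable_rank ν hν).hasSum (Filter.Eventually.of_forall ?_)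
  intro s
  induction s using Finset.induction_on with
  | empty =>
    simp only [Finset.sum_empty]
    exact isCompactOperator_zero
  | insert i s hi ih =>
    rw [Finset.sum_insert hi]
    refine IsCompactOperator.add ?_ ih
    rw [InnerProductSpace.rankOne_def']
    have h : IsCompactOperator (innerSL ℝ (bv ν i)) :=
      isCompactOperator_of_locallyCompactSpace_dom (innerSL ℝ (bv ν i))
    exact h.clm_comp (ContinuousLinearMap.toSpanSingleton ℝ (bv ν i))

lemma T_hasSum (ν : ℝ) (hν : 0 ≤ ν) (x : H) :
    HasSum (fun n => inner ℝ (bv ν n) x • bv ν n) (T ν x) := by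
  have := (summable_rank ν hν).hasSum.mapL (ContinuousLinearMap.apply ℝ H x)
  exact this

lemma T_inner (ν : ℝ) (hν : 0 ≤ ν) (x y : H) :
    HasSum (fun n => inner ℝ (bv ν n) x * inner ℝ (bv ν n) y) (inner ℝ y (T ν x)) := by
  have := (T_hasSum ν hν x).mapL (innerSL ℝ y)
  refine HasSum.congr_fun this fun n => ?_
  rw [innerSL_apply_apply, real_inner_smul_right, real_inner_comm y]

lemma T_symm (ν : ℝ) (hν : 0 ≤ ν) (x y : H) :
    inner ℝ (T ν x) y = inner ℝ x (T ν y) := by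
  rw [real_inner_comm]
  refine (T_inner ν hν x y).unique ?_
  convert T_inner ν hν y x using 1
  ext n; ring

lemma inner_bv_ev (ν : ℝ) (n m : ℕ) : inner ℝ (bv ν n) (ev m) =
    (pv ν n)⁻¹ * ((qv ν n)⁻¹ * (if n = m then 1 else 0) + (qv ν (n + 1))⁻¹ * (if n + 1 = m then 1 else 0)) := by
  rw [inner_bv, ev_apply, ev_apply]

lemma T_apply_zero (ν : ℝ) (hν : 0 ≤ ν) (x : H) :
    T ν x 0 = inner ℝ (bv ν 0) x * ((pv ν 0)⁻¹ * (qv ν 0)⁻¹) := by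
  rw [← inner_ev]
  refine (T_inner ν hν x (ev 0)).unique ?_
  have := hasSum_single (f := fun n => inner ℝ (bv ν n) x * inner ℝ (bv ν n) (ev 0)) 0 ?_
  · convert this using 1
    rw [inner_bv_ev]; simp
  · intro n hn
    rw [inner_bv_ev]; simp [hn]

lemma T_apply_succ (ν : ℝ) (hν : 0 ≤ ν) (x : H) (m : ℕ) :
    T ν x (m + 1) = inner ℝ (bv ν m) x * ((pv ν m)⁻¹ * (qv ν (m + 1))⁻¹) +
      inner ℝ (bv ν (m + 1)) x * ((pv ν (m + 1))⁻¹ * (qv ν (m + 1))⁻¹) := by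
  rw [← inner_ev]
  refine (T_inner ν hν x (ev (m + 1))).unique ?_
  have := hasSum_sum_of_ne_finset_zero (L := .unconditional ℕ) (f := fun n => inner ℝ (bv ν n) x * inner ℝ (bv ν n) (ev (m + 1)))
    (s := {m, m + 1}) ?_
  · convert this using 1
    rw [Finset.sum_pair (by omega), inner_bv_ev, inner_bv_ev]; simp
  · intro n hn
    simp at hn
    rw [inner_bv_ev]; simp [hn]

lemma T_nonneg (ν : ℝ) (hν : 0 ≤ ν) (x : H) : 0 ≤ inner ℝ x (T ν x) :=
  (T_inner ν hν x x).nonneg fun n => mul_self_nonneg _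

lemma T_inj (ν : ℝ) (hν : 0 ≤ ν) (x : H) (hx : T ν x = 0) : x = 0 := by
  have h1 := T_inner ν hν x x
  rw [hx, inner_zero_right, hasSum_zero_iff_of_nonneg (fun n => mul_self_nonneg _)] at h1
  have h2 : ∀ n, (qv ν n)⁻¹ * x n + (qv ν (n + 1))⁻¹ * x (n + 1) = 0 := by
    intro n
    have := congrFun h1 n
    simp only [Pi.zero_apply, mul_self_eq_zero] at this
    rw [inner_bv] at this
    exact (mul_eq_zero.mp this).resolve_left (inv_ne_zero (pv_pos ν hν n).ne')
  have h3 : ∀ n, (x n) ^ 2 = av ν n * ((qv ν 0)⁻¹ * x 0) ^ 2 := by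
    have h4 : ∀ n, ((qv ν n)⁻¹ * x n) ^ 2 = ((qv ν 0)⁻¹ * x 0) ^ 2 := by
      intro n
      induction n with
      | zero => rfl
      | succ n ih =>
        rw [← ih]
        have : (qv ν (n + 1))⁻¹ * x (n + 1) = - ((qv ν n)⁻¹ * x n) := by linarith [h2 n]
        rw [this]; ring
    intro n
    rw [← h4 n, ← qv_sq ν hν n]
    have := (qv_pos ν hν n).ne'
    field_simp
  have h5 : Summable (fun n => (x n) ^ 2) := by
    have := lp.summable_inner (𝕜 := ℝ) x x
    refine this.congr fun n => ?_
    simp [sq]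
  have h6 := h5.tendsto_atTop_zero
  have h7 : ((qv ν 0)⁻¹ * x 0) ^ 2 ≤ 0 := by
    refine ge_of_tendsto' h6 fun n => ?_
    rw [h3 n]
    have := av_ge ν hν n
    have h0 : (1 : ℝ) ≤ av ν n := by linarith [(Nat.cast_nonneg n : (0:ℝ) ≤ n)]
    nlinarith [sq_nonneg ((qv ν 0)⁻¹ * x 0)]
  have h8 : ((qv ν 0)⁻¹ * x 0) ^ 2 = 0 := le_antisymm h7 (sq_nonneg _)
  ext n
  have := h3 n
  rw [h8, mul_zero] at this
  simpa using this

/-- An eigenvector with vanishing first coordinate is zero. -/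
lemma eig_zero (ν : ℝ) (hν : 0 ≤ ν) (x : H) (μ : ℝ) (hx : T ν x = μ • x) (h0 : x 0 = 0) : x = 0 := by
  have key : ∀ n, x n = 0 ∧ inner ℝ (bv ν n) x = 0 := by
    intro n
    induction n with
    | zero =>
      refine ⟨h0, ?_⟩
      have := T_apply_zero ν hν x
      rw [hx] at this
      simp only [lp.coeFn_smul, Pi.smul_apply, h0, smul_zero] at this
      have p0 := (pv_pos ν hν 0).ne'
      have q0 := (qv_pos ν hν 0).ne'
      simpa [p0, q0] using this.symm
    | succ n ih =>
      have e1 : x (n + 1) = 0 := by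
        have := ih.2
        rw [inner_bv, ih.1] at this
        have p0 := (pv_pos ν hν n).ne'
        have q0 := (qv_pos ν hν (n + 1)).ne'
        simpa [p0, q0] using this
      refine ⟨e1, ?_⟩
      have := T_apply_succ ν hν x n
      rw [hx, ih.2] at this
      simp only [lp.coeFn_smul, Pi.smul_apply, e1, smul_zero] at this
      have p0 := (pv_pos ν hν (n + 1)).ne'
      have q0 := (qv_pos ν hν (n + 1)).ne'
      simpa [p0, q0] using this.symm
  ext n
  simpa using (key n).1

/-- coordinates of the solution vector -/
noncomputable def yc (ν z : ℝ) (n : ℕ) : ℝ := qv ν n * ((z / 4) ^ n * F (av ν n) z)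

lemma gamma_av (ν : ℝ) (hν : 0 ≤ ν) (n : ℕ) :
    av ν n * (Real.Gamma (ν + 1) ^ 2 * n.factorial) ≤ Real.Gamma (av ν n + 1) ^ 2 := by
  have ha := av_pos ν hν n
  have ha1 : 1 ≤ av ν n := by linarith [av_ge ν hν n, (Nat.cast_nonneg n : (0:ℝ) ≤ n)]
  have h1 := gamma_ge ν hν (2 * n)
  have h2 := gamma_pos1 ν hν
  have e : ν + (2 * n : ℕ) + 1 = av ν n := by unfold av; push_cast; ring
  rw [e] at h1
  have h3 : (n.factorial : ℝ) ≤ (2 * n).factorial := by exact_mod_cast Nat.factorial_le (by omega)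
  have h4 : (1 : ℝ) ≤ n.factorial := by exact_mod_cast Nat.one_le_iff_ne_zero.mpr (Nat.factorial_ne_zero n)
  have h5 : Real.Gamma (ν + 1) * n.factorial ≤ Real.Gamma (av ν n) :=
    (mul_le_mul_of_nonneg_left h3 h2.le).trans h1
  have h6 : Real.Gamma (ν + 1) ≤ Real.Gamma (av ν n) := by nlinarith
  rw [Real.Gamma_add_one ha.ne']
  calc av ν n * (Real.Gamma (ν + 1) ^ 2 * n.factorial)
      = av ν n * (Real.Gamma (ν + 1) * (Real.Gamma (ν + 1) * n.factorial)) := by ring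
    _ ≤ av ν n * (Real.Gamma (av ν n) * Real.Gamma (av ν n)) := by gcongr
    _ ≤ (av ν n * av ν n) * (Real.Gamma (av ν n) * Real.Gamma (av ν n)) := by
        gcongr
        nlinarith
    _ = _ := by ring

lemma yc_bd (ν : ℝ) (hν : 0 ≤ ν) (M z w : ℝ) (hz : |z| ≤ M) (hw : |w| ≤ M) (n : ℕ) :
    ‖yc ν z n * yc ν w n‖ ≤ (Real.exp (M / 4) ^ 2 / Real.Gamma (ν + 1) ^ 2) * (((M / 4) ^ 2) ^ n / n.factorial) := by
  have ha := av_pos ν hν n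
  have h1 := abs_F_le (av ν n) z M ha.le hz
  have h2 := abs_F_le (av ν n) w M ha.le hw
  have h3 := gamma_av ν hν n
  have g := gamma_pos1 ν hν
  have g' := gamma_pos1 (av ν n) ha.le
  have hM : 0 ≤ M := (abs_nonneg z).trans hz
  have e : yc ν z n * yc ν w n = av ν n * (((z / 4) ^ n * (w / 4) ^ n) * (F (av ν n) z * F (av ν n) w)) := by
    unfold yc; linear_combination (((z / 4) ^ n * (w / 4) ^ n) * (F (av ν n) z * F (av ν n) w)) * qv_sq ν hν n
  rw [e, norm_mul, norm_mul, norm_mul, norm_mul, norm_pow, norm_pow, norm_div, norm_div,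
    Real.norm_of_nonneg ha.le]
  simp only [Real.norm_eq_abs]
  rw [abs_of_pos (by norm_num : (0:ℝ) < 4)]
  calc av ν n * (((|z| / 4) ^ n * (|w| / 4) ^ n) * (|F (av ν n) z| * |F (av ν n) w|))
      ≤ av ν n * (((M / 4) ^ n * (M / 4) ^ n) * ((Real.exp (M / 4) / Real.Gamma (av ν n + 1)) *
          (Real.exp (M / 4) / Real.Gamma (av ν n + 1)))) := by gcongr
    _ = ((M / 4) ^ 2) ^ n * Real.exp (M / 4) ^ 2 * (av ν n / Real.Gamma (av ν n + 1) ^ 2) := by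
        rw [← pow_mul, mul_comm 2 n, pow_mul, sq ((M / 4) ^ n)]
        ring
    _ ≤ ((M / 4) ^ 2) ^ n * Real.exp (M / 4) ^ 2 * (1 / (Real.Gamma (ν + 1) ^ 2 * n.factorial)) := by
        refine mul_le_mul_of_nonneg_left ?_ (by positivity)
        rw [div_le_div_iff₀ (by positivity) (by positivity)]
        linarith
    _ = _ := by field_simp

lemma summable_yc_bd (M C : ℝ) : Summable (fun n : ℕ => C * (((M / 4) ^ 2) ^ n / n.factorial)) :=
  (Real.summable_pow_div_factorial _).mul_left _

/-- The solution vector in `ℓ²`. -/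
noncomputable def yv (ν : ℝ) (hν : 0 ≤ ν) (z : ℝ) : H :=
  ⟨yc ν z, by
    refine memℓp_gen ?_
    have := Summable.of_norm_bounded (summable_yc_bd |z| _) (yc_bd ν hν |z| z z le_rfl le_rfl)
    refine this.congr fun n => ?_
    simp [sq]⟩

lemma yv_apply (ν : ℝ) (hν : 0 ≤ ν) (z : ℝ) (n : ℕ) :
    yv ν hν z n = qv ν n * ((z / 4) ^ n * F (av ν n) z) := rfl

lemma inner_yv (ν : ℝ) (hν : 0 ≤ ν) (z w : ℝ) :
    inner ℝ (yv ν hν z) (yv ν hν w) = ∑' n, yc ν z n * yc ν w n := by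
  rw [lp.inner_eq_tsum]
  refine tsum_congr fun n => ?_
  show inner ℝ (yc ν z n) (yc ν w n) = _
  simp [mul_comm]

lemma F_cont (μ : ℝ) (hμ : 0 ≤ μ) : Continuous (F μ) :=
  continuous_iff_continuousAt.mpr fun z => (F_hasDerivAt μ z hμ).continuousAt

lemma inner_yv_cont (ν : ℝ) (hν : 0 ≤ ν) (z : ℝ) :
    ContinuousAt (fun w => inner ℝ (yv ν hν z) (yv ν hν w)) z := by
  simp only [inner_yv]
  have : ContinuousOn (fun w => ∑' n, yc ν z n * yc ν w n) (Metric.ball 0 (|z| + 1)) := by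
    refine continuousOn_tsum (fun n => ?_) (summable_yc_bd (|z| + 1)
      (Real.exp ((|z| + 1) / 4) ^ 2 / Real.Gamma (ν + 1) ^ 2)) (fun n w hw => ?_)
    · have := F_cont (av ν n) (av_pos ν hν n).le
      unfold yc
      fun_prop
    · exact yc_bd ν hν (|z| + 1) z w (by linarith) (by simpa using (mem_ball_zero_iff.mp hw).le) n
  exact this.continuousAt (Metric.isOpen_ball.mem_nhds (by simp))

lemma inner_bv_yv (ν : ℝ) (hν : 0 ≤ ν) (z : ℝ) (n : ℕ) :
    inner ℝ (bv ν n) (yv ν hν z) = pv ν n * ((z / 4) ^ n * F (av ν n + 1) z) := by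
  rw [inner_bv, yv_apply, yv_apply]
  have q0 := (qv_pos ν hν n).ne'
  have q1 := (qv_pos ν hν (n + 1)).ne'
  have p0 := (pv_pos ν hν n).ne'
  have h := F_rec (av ν n) z (av_pos ν hν n).le
  have e : av ν (n + 1) = av ν n + 2 := by unfold av; push_cast; ring
  rw [e, h, inv_mul_cancel_left₀ q0, inv_mul_cancel_left₀ q1, pow_succ, inv_mul_eq_iff_eq_mul₀ p0,
    ← mul_assoc (pv ν n), pv_sq ν hν]
  ring

lemma T_yv (ν : ℝ) (hν : 0 ≤ ν) (z : ℝ) (hz : z ≠ 0) :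
    T ν (yv ν hν z) = (4 / z) • (yv ν hν z - (F ν z / qv ν 0) • ev 0) := by
  ext n
  have q0 := (qv_pos ν hν n).ne'
  have p0 := (pv_pos ν hν n).ne'
  have hq := qv_sq ν hν n
  simp only [lp.coeFn_smul, lp.coeFn_sub, Pi.smul_apply, Pi.sub_apply, smul_eq_mul]
  rcases n with _ | n
  · rw [T_apply_zero ν hν, inner_bv_yv, yv_apply, ev_apply]
    have h := F_rec ν z hν
    have e : av ν 0 = ν + 1 := by unfold av; simp
    rw [e] at hq
    rw [e, show ν + 1 + 1 = ν + 2 by ring]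
    simp only [pow_zero, one_mul, if_true, mul_one]
    rw [h]
    field_simp
    rw [sq, hq]
    ring
  · rw [T_apply_succ ν hν, inner_bv_yv, inner_bv_yv, yv_apply, ev_apply]
    have p1 := (pv_pos ν hν n).ne'
    have h := F_rec (av ν n + 1) z (by have := av_pos ν hν n; linarith)
    have e : av ν (n + 1) = av ν n + 2 := by unfold av; push_cast; ring
    rw [e] at hq
    rw [e]
    rw [show av ν n + 1 + 1 = av ν n + 2 by ring, show av ν n + 1 + 2 = av ν n + 2 + 1 by ring] at h
    rw [h]
    simp only [Nat.succ_ne_zero, if_false, mul_zero, sub_zero, pow_succ]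
    field_simp
    rw [sq, hq]
    ring

lemma F_succ_ne (ν : ℝ) (hν : 0 ≤ ν) (l : ℝ) (hl : l ≠ 0) (h : F ν l = 0) : F (ν + 1) l ≠ 0 :=
  fun h1 => F_not_both ν l hν hl h h1

lemma yv_zero (ν : ℝ) (hν : 0 ≤ ν) (z : ℝ) : yv ν hν z 0 = qv ν 0 * F (ν + 1) z := by
  rw [yv_apply]
  simp [av]

lemma T_eig (ν : ℝ) (hν : 0 ≤ ν) (l : ℝ) (hl : l ≠ 0) (h : F ν l = 0) :
    T ν (yv ν hν l) = (4 / l) • yv ν hν l := by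
  rw [T_yv ν hν l hl, h]
  simp

lemma inner_yv_mul (ν : ℝ) (hν : 0 ≤ ν) (l s : ℝ) (hl : l ≠ 0) (hs : s ≠ 0) (h : F ν l = 0) :
    inner ℝ (yv ν hν l) (yv ν hν s) * (l - s) = l * F ν s * F (ν + 1) l := by
  have h1 := T_symm ν hν (yv ν hν l) (yv ν hν s)
  rw [T_eig ν hν l hl h, T_yv ν hν s hs, real_inner_smul_left, real_inner_smul_right,
    inner_sub_right, real_inner_smul_right, real_inner_comm (ev 0), inner_ev, yv_zero] at h1
  have q0 := (qv_pos ν hν 0).ne'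
  field_simp at h1
  linear_combination -h1

lemma norm_yv (ν : ℝ) (hν : 0 ≤ ν) (l : ℝ) (hl : l ≠ 0) (h : F ν l = 0) :
    inner ℝ (yv ν hν l) (yv ν hν l) = l / 4 * F (ν + 1) l ^ 2 := by
  have h1 : Filter.Tendsto (fun w => inner ℝ (yv ν hν l) (yv ν hν w)) (nhdsWithin l {l}ᶜ)
      (nhds (inner ℝ (yv ν hν l) (yv ν hν l))) :=
    (inner_yv_cont ν hν l).tendsto.mono_left nhdsWithin_le_nhds
  have h2 := (hasDerivAt_iff_tendsto_slope.mp (F_hasDerivAt ν l hν)).const_mul (-(l * F (ν + 1) l))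
  have h3 : Filter.Tendsto (fun w => inner ℝ (yv ν hν l) (yv ν hν w)) (nhdsWithin l {l}ᶜ)
      (nhds (-(l * F (ν + 1) l) * (-(F (ν + 1) l) / 4))) := by
    refine h2.congr' ?_
    have hn : ∀ᶠ w in nhdsWithin l {l}ᶜ, w ≠ 0 :=
      nhdsWithin_le_nhds (isOpen_ne.mem_nhds hl)
    filter_upwards [hn, self_mem_nhdsWithin] with w hw hwl
    have hwl' : w - l ≠ 0 := sub_ne_zero.mpr hwl
    have := inner_yv_mul ν hν l w hl hw h
    rw [slope_def_field, h, sub_zero]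
    field_simp
    linear_combination this
  rw [tendsto_nhds_unique h1 h3]
  ring

/-- Normalised eigenvectors. -/
noncomputable def vv (ν : ℝ) (hν : 0 ≤ ν) (x : besselZeros ν) : H :=
  ‖yv ν hν ((x : ℝ) ^ 2)‖⁻¹ • yv ν hν ((x : ℝ) ^ 2)

lemma zero_pos (ν : ℝ) (x : besselZeros ν) : 0 < (x : ℝ) := ((mem_zeros ν x).mp x.2).1
lemma zero_F (ν : ℝ) (x : besselZeros ν) : F ν ((x : ℝ) ^ 2) = 0 := ((mem_zeros ν x).mp x.2).2

lemma norm_pos_yv (ν : ℝ) (hν : 0 ≤ ν) (x : besselZeros ν) : 0 < ‖yv ν hν ((x : ℝ) ^ 2)‖ := by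
  have hx := zero_pos ν x
  have h := norm_yv ν hν ((x : ℝ) ^ 2) (by positivity) (zero_F ν x)
  have h1 := F_succ_ne ν hν ((x : ℝ) ^ 2) (by positivity) (zero_F ν x)
  rw [norm_pos_iff]
  intro h0
  rw [h0, inner_zero_left] at h
  have : 0 < (x : ℝ) ^ 2 / 4 * F (ν + 1) ((x : ℝ) ^ 2) ^ 2 := by positivity
  linarith

lemma vv_orthonormal (ν : ℝ) (hν : 0 ≤ ν) : Orthonormal ℝ (vv ν hν) := by
  constructor
  · intro x
    unfold vv
    rw [norm_smul, norm_inv, norm_norm]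
    exact inv_mul_cancel₀ (norm_pos_yv ν hν x).ne'
  · intro x y hxy
    have hx := zero_pos ν x
    have hy := zero_pos ν y
    show inner ℝ (vv ν hν x) (vv ν hν y) = 0
    unfold vv
    rw [real_inner_smul_left, real_inner_smul_right]
    have h := inner_yv_mul ν hν ((x : ℝ) ^ 2) ((y : ℝ) ^ 2) (by positivity) (by positivity) (zero_F ν x)
    rw [zero_F ν y, mul_zero, zero_mul] at h
    have hne : (x : ℝ) ^ 2 - (y : ℝ) ^ 2 ≠ 0 := by
      intro h0
      apply hxy
      apply Subtype.ext
      exact (sq_eq_sq₀ hx.le hy.le).mp (by linarith)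
    rw [(mul_eq_zero.mp h).resolve_right hne]
    simp

lemma eig_le (ν : ℝ) (hν : 0 ≤ ν) (μ : ℝ) (x : H) (hx : T ν x = μ • x) :
    x ∈ Submodule.span ℝ (Set.range (vv ν hν)) := by
  by_cases hx0 : x = 0
  · rw [hx0]; exact Submodule.zero_mem _
  have hn : 0 < ‖x‖ := norm_pos_iff.mpr hx0
  have hμ : 0 < μ := by
    have h1 := T_nonneg ν hν x
    rw [hx, real_inner_smul_right, real_inner_self_eq_norm_sq] at h1
    have h2 : 0 ≤ μ := nonneg_of_mul_nonneg_left h1 (by positivity)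
    rcases h2.lt_or_eq with h | h
    · exact h
    · exfalso
      apply hx0
      apply T_inj ν hν
      rw [hx, ← h, zero_smul]
  have hx00 : x 0 ≠ 0 := fun h => hx0 (eig_zero ν hν x μ hx h)
  set l := 4 / μ with hl
  have hlpos : 0 < l := by positivity
  have hml : 4 / l = μ := by rw [hl]; field_simp
  have hF : F ν l = 0 := by
    have h1 := T_symm ν hν x (yv ν hν l)
    rw [hx, T_yv ν hν l hlpos.ne', hml, real_inner_smul_left, real_inner_smul_right, inner_sub_right,
      real_inner_smul_right, real_inner_comm (ev 0), inner_ev] at h1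
    have q0 := (qv_pos ν hν 0).ne'
    have h2 : F ν l / qv ν 0 * x 0 = 0 := by
      have := mul_left_cancel₀ hμ.ne' h1
      linarith
    rcases mul_eq_zero.mp h2 with h | h
    · exact (div_eq_zero_iff.mp h).resolve_right q0
    · exact absurd h hx00
  have hmem : Real.sqrt l ∈ besselZeros ν := by
    rw [mem_zeros]
    exact ⟨Real.sqrt_pos.mpr hlpos, by rw [Real.sq_sqrt hlpos.le]; exact hF⟩
  have hy0 : yv ν hν l 0 ≠ 0 := by
    rw [yv_zero]
    exact mul_ne_zero (qv_pos ν hν 0).ne' (F_succ_ne ν hν l hlpos.ne' hF)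
  have hd : x - (x 0 / yv ν hν l 0) • yv ν hν l = 0 := by
    apply eig_zero ν hν _ μ
    · rw [map_sub, map_smul, T_eig ν hν l hlpos.ne' hF, hml, hx, smul_sub, smul_comm]
    · simp only [lp.coeFn_smul, lp.coeFn_sub, Pi.smul_apply, Pi.sub_apply, smul_eq_mul]
      rw [div_mul_cancel₀ _ hy0, sub_self]
  have hv : vv ν hν ⟨Real.sqrt l, hmem⟩ = ‖yv ν hν l‖⁻¹ • yv ν hν l := by
    unfold vv
    simp only [Real.sq_sqrt hlpos.le]
  have hnp := norm_pos_yv ν hν ⟨Real.sqrt l, hmem⟩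
  simp only [Real.sq_sqrt hlpos.le] at hnp
  have hfin : x = (x 0 / yv ν hν l 0 * ‖yv ν hν l‖) • vv ν hν ⟨Real.sqrt l, hmem⟩ := by
    rw [hv, smul_smul, mul_assoc, mul_inv_cancel₀ hnp.ne', mul_one]
    exact sub_eq_zero.mp hd
  rw [hfin]
  exact Submodule.smul_mem _ _ (Submodule.subset_span ⟨_, rfl⟩)

lemma vv_complete (ν : ℝ) (hν : 0 ≤ ν) : (Submodule.span ℝ (Set.range (vv ν hν)))ᗮ = ⊥ := by
  have h := ContinuousLinearMap.orthogonalComplement_iSup_eigenspaces_eq_bot (T_compact ν hν)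
    (fun x y => T_symm ν hν x y)
  rw [eq_bot_iff, ← h]
  refine Submodule.orthogonal_le (iSup_le fun μ => ?_)
  intro x hx
  exact eig_le ν hν μ x (Module.End.mem_eigenspace_iff.mp hx)

lemma partial_fraction (ν : ℝ) (hν : 0 ≤ ν) (s : ℝ) (hs : s ≠ 0) (hF : F ν s ≠ 0) :
    HasSum (fun x : besselZeros ν => 1 / ((x : ℝ) ^ 2 - s)) (F (ν + 1) s / (4 * F ν s)) := by
  have q0 := (qv_pos ν hν 0).ne'
  have h := (HilbertBasis.mkOfOrthogonalEqBot (vv_orthonormal ν hν)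
    (vv_complete ν hν)).hasSum_inner_mul_inner (ev 0) (yv ν hν s)
  rw [HilbertBasis.coe_mkOfOrthogonalEqBot, inner_ev, yv_zero] at h
  have h2 := h.div_const (qv ν 0 * (4 * F ν s))
  rw [mul_div_mul_left _ _ q0] at h2
  refine h2.congr_fun fun x => ?_
  have hx := zero_pos ν x
  have hxF := zero_F ν x
  have hn := norm_pos_yv ν hν x
  have hl : ((x : ℝ) ^ 2) ≠ 0 := by positivity
  have hi := norm_yv ν hν _ hl hxF
  have hm := inner_yv_mul ν hν _ s hl hs hxF
  have hG := F_succ_ne ν hν _ hl hxF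
  have hne : (x : ℝ) ^ 2 - s ≠ 0 := by
    intro h0
    apply hF
    rw [← sub_eq_zero.mp h0]; exact hxF
  rw [real_inner_self_eq_norm_sq] at hi
  unfold vv
  rw [real_inner_smul_right, real_inner_smul_left, inner_ev, yv_zero]
  set N := ‖yv ν hν ((x : ℝ) ^ 2)‖ with hN
  set I : ℝ := inner ℝ (yv ν hν ((x : ℝ) ^ 2)) (yv ν hν s) with hI
  rw [eq_div_iff_mul_eq hne |>.mpr hm]
  field_simp
  rw [hi]
  field_simp

end BesselAux

open BesselAux
/-- If `ν ≥ 0` and `s` is the smallest positive zero of `φ_ν'`, then the series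
`Σ_{x ∈ Z_ν} 1/(x² - s)` converges and `1/s = Σ_{x ∈ Z_ν} 1/(x² - s)`. -/
theorem phi_deriv_zero_partial_fraction (ν : ℝ) (hν : 0 ≤ ν) (s : ℝ)
    (hs : IsLeast {x : ℝ | 0 < x ∧ deriv (phi ν) x = 0} s) :
    Summable (fun x : besselZeros ν => 1 / ((x : ℝ) ^ 2 - s)) ∧
    1 / s = ∑' x : besselZeros ν, 1 / ((x : ℝ) ^ 2 - s) := by
  obtain ⟨hs0, hd⟩ := hs.1
  have hD : HasDerivAt (phi ν) (1 * (Real.Gamma (ν + 1) * F ν s) +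
      s * (Real.Gamma (ν + 1) * (-(F (ν + 1) s) / 4))) s := by
    rw [phi_eq]
    exact (hasDerivAt_id s).mul ((F_hasDerivAt ν s hν).const_mul _)
  rw [hD.deriv] at hd
  have g := (gamma_pos1 ν hν).ne'
  have hd' : F ν s = s / 4 * F (ν + 1) s := by
    have : Real.Gamma (ν + 1) * (F ν s - s / 4 * F (ν + 1) s) = 0 := by linarith
    linarith [(mul_eq_zero.mp this).resolve_left g]
  have hF : F ν s ≠ 0 := by
    intro h0
    have h1 := F_succ_ne ν hν s hs0.ne' h0
    rw [h0] at hd'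
    have : s / 4 * F (ν + 1) s ≠ 0 := mul_ne_zero (by positivity) h1
    exact this hd'.symm
  have hG : F (ν + 1) s ≠ 0 := by
    intro h0; rw [h0, mul_zero] at hd'; exact hF hd'
  have h := partial_fraction ν hν s hs0.ne' hF
  have e : F (ν + 1) s / (4 * F ν s) = 1 / s := by
    rw [hd']; field_simp
  rw [e] at h
  exact ⟨h.summable, h.tsum_eq.symm⟩
end
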